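/- arXiv:2506.02885 — 2 statements merged into one kernel-verified Lean document; each statement's English description precedes it below -/
import Mathlib

section
/- Let G be a finite non-solvable group. Then any two nilpotent maximal subgroups of G are conjugate in G. -/
open Subgroup
open scoped commutatorElement

section Elements

variable {G : Type*} [Group G] [Finite G] {p : ℕ}

theorem exists_not_dvd_orderOf_pow (hp : p.Prime) (g : G) : ∃ k, ¬ p ∣ orderOf (g ^ p ^ k) := by
  obtain ⟨k, m, hm, h⟩ := Nat.exists_eq_pow_mul_and_not_dvd (orderOf_pos g).ne' p hp.ne_one
  refine ⟨k, ?_⟩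
  rwa [orderOf_pow_of_dvd (pow_ne_zero _ hp.ne_zero) (h ▸ dvd_mul_right _ _), h,
    Nat.mul_div_cancel_left _ (pow_pos hp.pos _)]

omit [Finite G] in
theorem mem_of_pow_prime_pow_mem (hp : p.Prime) {H : Subgroup G} {x : G} (hx : ¬ p ∣ orderOf x)
    {k : ℕ} (h : x ^ p ^ k ∈ H) : x ∈ H := by
  have : x ∈ zpowers (x ^ p ^ k) :=
    mem_zpowers_pow_iff.2 ((hp.coprime_iff_not_dvd.2 hx).pow_left k)
  exact (zpowers_le.2 h) this

theorem exists_mul_eq_of_prime (hp : p.Prime) (g : G) :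
    ∃ u ∈ zpowers g, ∃ v ∈ zpowers g, g = u * v ∧ (∃ k, u ^ p ^ k = 1) ∧ ¬ p ∣ orderOf v := by
  obtain ⟨k, hk⟩ := exists_not_dvd_orderOf_pow hp g
  set w := g ^ p ^ k with hw
  have hw1 : w ∈ zpowers (w ^ p ^ k) :=
    mem_zpowers_pow_iff.2 ((hp.coprime_iff_not_dvd.2 hk).pow_left k)
  obtain ⟨j, hj⟩ := mem_zpowers_iff.1 hw1
  have hwg : w ∈ zpowers g := pow_mem (mem_zpowers g) _
  have hc : Commute g (w ^ j) := by
    rw [hw]; exact ((Commute.refl g).pow_right _).zpow_right _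
  refine ⟨g * (w ^ j)⁻¹, mul_mem (mem_zpowers g) (inv_mem (zpow_mem hwg _)), w ^ j,
    zpow_mem hwg _, by group, ⟨k, ?_⟩, fun h => hk (h.trans (orderOf_dvd_of_mem_zpowers
      (zpow_mem (mem_zpowers w) j)))⟩
  rw [hc.inv_right.mul_pow, ← hw, inv_pow, mul_inv_eq_one, ← zpow_natCast (w ^ j), ← zpow_mul,
    mul_comm, zpow_mul, zpow_natCast, hj]

omit [Finite G] in
theorem eq_one_of_pow_prime_pow (hp : p.Prime) {x : G} (hx : ¬ p ∣ orderOf x) {k : ℕ}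
    (h : x ^ p ^ k = 1) : x = 1 := by
  simpa using mem_of_pow_prime_pow_mem (H := ⊥) hp hx (by simpa using h)

omit [Finite G] in
theorem IsPGroup.eq_one_of_not_dvd (hp : p.Prime) {D : Subgroup G} (hD : IsPGroup p D) {x : G}
    (hxD : x ∈ D) (hx : ¬ p ∣ orderOf x) : x = 1 := by
  obtain ⟨k, hk⟩ := hD ⟨x, hxD⟩
  exact eq_one_of_pow_prime_pow hp hx (by simpa [Subtype.ext_iff] using hk)

/-- A subgroup generated by a Sylow subgroup and a normal subgroup containing all elements of
order prime to `p` is everything. -/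
theorem Sylow.sup_eq_top_of_forall_mem [Fact p.Prime] (S : Sylow p G) {C : Subgroup G} [C.Normal]
    (hC : ∀ x : G, ¬ p ∣ orderOf x → x ∈ C) : (S : Subgroup G) ⊔ C = ⊤ := by
  have hp := Fact.out (p := p.Prime)
  have h1 : IsPGroup p (G ⧸ C) := by
    intro q
    obtain ⟨g, rfl⟩ := QuotientGroup.mk_surjective q
    obtain ⟨k, hk⟩ := exists_not_dvd_orderOf_pow hp g
    exact ⟨k, by rw [← QuotientGroup.mk_pow, QuotientGroup.eq_one_iff]; exact hC _ hk⟩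
  obtain ⟨n, hn⟩ := h1.exists_card_eq
  rw [← index_eq_card] at hn
  have h2 : (S ⊔ C : Subgroup G).index ∣ p ^ n := hn ▸ index_dvd_of_le le_sup_right
  have h3 : (S ⊔ C : Subgroup G).index ∣ (S : Subgroup G).index := index_dvd_of_le le_sup_left
  obtain ⟨m, -, hm⟩ := (Nat.dvd_prime_pow hp).1 h2
  rw [← index_eq_one, hm]
  rcases m with _ | m
  · simp
  · exact absurd ((Dvd.intro_left _ (pow_succ p m).symm).trans (hm ▸ h3)) S.not_dvd_index

theorem IsPGroup.exists_mem_normalizer_of_lt [Fact p.Prime] {S D : Subgroup G} (hS : IsPGroup p S)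
    (h : D < S) : ∃ g ∈ S, g ∉ D ∧ g ∈ normalizer (D : Set G) := by
  have : Group.IsNilpotent S := hS.isNilpotent
  have h1 : D.subgroupOf S < ⊤ := by
    rw [lt_top_iff_ne_top, Ne, subgroupOf_eq_top]
    exact h.not_ge
  obtain ⟨g, hg, hgD⟩ := SetLike.exists_of_lt (Group.normalizerCondition_of_isNilpotent _ h1)
  refine ⟨g, g.2, hgD, ?_⟩
  rw [mem_normalizer_iff] at hg ⊢
  intro n
  constructor
  · intro hn
    exact (hg ⟨n, h.le hn⟩).1 hn
  · intro hn
    have hnS : n ∈ S := by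
      have := mul_mem (mul_mem (inv_mem g.2) (h.le hn)) g.2
      simpa [mul_assoc] using this
    exact (hg ⟨n, hnS⟩).2 hn

end Elements

/-- Frobenius' condition for a subgroup `H` to have a normal `p`-complement. -/
def FrobeniusCondition {G : Type*} [Group G] (p : ℕ) (H : Subgroup G) : Prop :=
  ∀ D ≤ H, IsPGroup p D → ∀ x ∈ H, x ∈ normalizer (D : Set G) → ¬ p ∣ orderOf x →
    ∀ d ∈ D, x * d = d * x

namespace FrobeniusCondition

variable {G G' : Type*} [Group G] [Group G'] {p : ℕ}

theorem mono {H K : Subgroup G} (h : FrobeniusCondition p H) (hKH : K ≤ H) :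
    FrobeniusCondition p K :=
  fun D hD hDp x hx => h D (hD.trans hKH) hDp x (hKH hx)

theorem of_map {f : G →* G'} (hf : Function.Injective f) {H : Subgroup G}
    (h : FrobeniusCondition p (H.map f)) : FrobeniusCondition p H := by
  intro D hD hDp x hx hxD hxp d hd
  apply hf
  rw [map_mul, map_mul]
  refine h (D.map f) (map_mono hD) (hDp.map f) (f x) (mem_map_of_mem f hx) ?_
    (by rwa [orderOf_injective f hf]) (f d) (mem_map_of_mem f hd)
  exact le_normalizer_map f (mem_map_of_mem f hxD)

theorem map {f : G →* G'} (hf : Function.Injective f) {H : Subgroup G}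
    (h : FrobeniusCondition p H) : FrobeniusCondition p (H.map f) := by
  rintro D hD hDp _ ⟨x, hx, rfl⟩ hxD hxp d hd
  obtain ⟨d, hdH, rfl⟩ := hD hd
  rw [← map_mul, ← map_mul]
  congr 1
  refine h (D.comap f) ?_ (hDp.comap_of_injective f hf) x hx ?_
    (by rwa [orderOf_injective f hf] at hxp) d hd
  · intro y hy
    obtain ⟨z, hz, hzy⟩ := hD hy
    exact hf hzy ▸ hz
  · rw [mem_normalizer_iff] at hxD ⊢
    intro n
    simpa using hxD (f n)

theorem top_iff {H : Subgroup G} :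
    FrobeniusCondition p (⊤ : Subgroup H) ↔ FrobeniusCondition p H := by
  have hm : (⊤ : Subgroup H).map H.subtype = H := by
    rw [← MonoidHom.range_eq_map, range_subtype]
  exact ⟨fun h => hm ▸ h.map H.subtype_injective,
    fun h => of_map H.subtype_injective (hm.symm ▸ h)⟩

theorem of_normal [Finite G] [Fact p.Prime] (K : Subgroup G) [K.Normal] (hK : ¬ p ∣ Nat.card K)
    (h : ∀ x : G, ¬ p ∣ orderOf x → x ∈ K) : FrobeniusCondition p (⊤ : Subgroup G) := by
  intro D _ hD x _ hxD hx d hd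
  have hp := Fact.out (p := p.Prime)
  have h1 : x * d * x⁻¹ * d⁻¹ ∈ D := mul_mem ((mem_normalizer_iff.1 hxD d).1 hd) (inv_mem hd)
  have h2 : x * d * x⁻¹ * d⁻¹ ∈ K := by
    have := mul_mem (h x hx) (Normal.conj_mem ‹K.Normal› _ (inv_mem (h x hx)) d)
    simpa [mul_assoc] using this
  have h3 : x * d * x⁻¹ * d⁻¹ = 1 := hD.eq_one_of_not_dvd hp h1 fun h =>
    hK (h.trans (K.orderOf_dvd_natCard h2))
  rw [mul_inv_eq_one, mul_inv_eq_iff_eq_mul] at h3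
  exact h3

variable [Finite G] [Fact p.Prime]

theorem exists_mem_centralizer_smul_eq (h : FrobeniusCondition p (⊤ : Subgroup G))
    (S T : Sylow p G) : ∃ c ∈ centralizer ((S ⊓ T : Subgroup G) : Set G), c • S = T := by
  have hp := Fact.out (p := p.Prime)
  induction hn : Nat.card G - Nat.card (S ⊓ T : Subgroup G) using Nat.strong_induction_on
    generalizing S T with
  | _ n ih =>
  subst hn
  by_cases hST : S = T
  · exact ⟨1, one_mem _, by simp [hST]⟩
  set D : Subgroup G := S ⊓ T with hD
  have hDS : D < S := lt_of_le_of_ne inf_le_left fun e =>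
    hST (Sylow.ext (S.3 T.2 (inf_eq_left.1 e)).symm)
  have hDT : D < T := lt_of_le_of_ne inf_le_right fun e =>
    hST (Sylow.ext (T.3 S.2 (inf_eq_right.1 e)))
  set N := normalizer (D : Set G) with hN
  have key : ∀ A B : Subgroup G, D ≤ A → D ≤ B → ∀ g ∈ A, g ∈ B → g ∉ D →
      Nat.card G - Nat.card (A ⊓ B : Subgroup G) < Nat.card G - Nat.card D := by
    intro A B hA hB g hgA hgB hgD
    have h1 : Nat.card D < Nat.card (A ⊓ B : Subgroup G) :=
      Set.ncard_lt_ncard (s := (D : Set G)) (t := ((A ⊓ B : Subgroup G) : Set G))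
        (SetLike.coe_ssubset_coe.2 (lt_of_le_of_ne (le_inf hA hB) fun e => hgD (e ▸ ⟨hgA, hgB⟩)))
    have h2 : Nat.card (A ⊓ B : Subgroup G) ≤ Nat.card G :=
      Nat.le_of_dvd Nat.card_pos (card_subgroup_dvd_card _)
    omega
  obtain ⟨S1, hS1⟩ := (S.2.comap_subtype (K := N)).exists_le_sylow
  obtain ⟨T1, hT1⟩ := (T.2.comap_subtype (K := N)).exists_le_sylow
  obtain ⟨m, hm⟩ := MulAction.exists_smul_eq N S1 T1
  let C : Subgroup N := (centralizer (D : Set G)).subgroupOf N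
  have hCn : C.Normal := by
    refine ⟨fun c hc g => ?_⟩
    rw [mem_subgroupOf, mem_centralizer_iff] at hc ⊢
    intro d hd
    have h1 := hc ((g : G)⁻¹ * d * g) (by
      have := (mem_normalizer_iff.1 (inv_mem g.2) d).1 hd
      simpa using this)
    push_cast
    have h2 := congrArg (fun t => (g : G) * t * (g : G)⁻¹) h1
    simpa [mul_assoc] using h2
  have hSC : (S1 : Subgroup N) ⊔ C = ⊤ := S1.sup_eq_top_of_forall_mem fun x hx => by
    rw [mem_subgroupOf, mem_centralizer_iff]
    exact fun d hd => (h D le_top (S.2.to_le hDS.le) x (mem_top _) x.2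
      (by rwa [Subgroup.orderOf_coe]) d hd).symm
  have hm' : m ∈ C ⊔ (S1 : Subgroup N) := by rw [sup_comm, hSC]; trivial
  obtain ⟨c, hc, s, hs, rfl⟩ := mem_sup_of_normal_left.1 hm'
  have hs1 : s • S1 = S1 := Sylow.smul_eq_iff_mem_normalizer.2 (le_normalizer hs)
  rw [mul_smul, hs1] at hm
  obtain ⟨S2, hS2⟩ := (S1.2.map N.subtype).exists_le_sylow
  have hcD : (c : G) ∈ centralizer (D : Set G) := hc
  have hDN : D ≤ N := le_normalizer
  have hS2' : ∀ g ∈ (S : Subgroup G), g ∈ N → g ∈ (S2 : Subgroup G) := fun g hg hgN =>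
    hS2 ⟨⟨g, hgN⟩, hS1 hg, rfl⟩
  have hT2' : ∀ g ∈ (T : Subgroup G), g ∈ N → g ∈ (((c : G) • S2 : Sylow p G) : Subgroup G) := by
    intro g hg hgN
    have h1 : (⟨g, hgN⟩ : N) ∈ (T1 : Subgroup N) := hT1 hg
    rw [← hm, Sylow.coe_subgroup_smul, Subgroup.mem_pointwise_smul_iff_inv_smul_mem] at h1
    rw [Sylow.coe_subgroup_smul, Subgroup.mem_pointwise_smul_iff_inv_smul_mem]
    exact hS2 ⟨_, h1, by simp [MulAut.smul_def, ← map_inv]⟩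
  obtain ⟨g, hgS, hgD, hgN⟩ := S.2.exists_mem_normalizer_of_lt hDS
  obtain ⟨c1, hc1, e1⟩ := ih _ (key S S2 hDS.le (fun d hd => hS2' d (hDS.le hd) (hDN hd)) g hgS
    (hS2' g hgS hgN) hgD) S S2 rfl
  obtain ⟨g, hgT, hgD, hgN⟩ := T.2.exists_mem_normalizer_of_lt hDT
  obtain ⟨c2, hc2, e2⟩ := ih _ (key ((c : G) • S2 : Sylow p G) T
    (fun d hd => hT2' d (hDT.le hd) (hDN hd)) hDT.le g (hT2' g hgT hgN) hgT hgD) _ T rfl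
  refine ⟨c2 * (c * c1), mul_mem ?_ (mul_mem hcD ?_), by rw [mul_smul, mul_smul, e1, e2]⟩
  · exact centralizer_le (le_inf (fun d hd => hT2' d (hDT.le hd) (hDN hd)) hDT.le : D ≤ _) hc2
  · exact centralizer_le (le_inf hDS.le (fun d hd => hS2' d (hDS.le hd) (hDN hd)) : D ≤ _) hc1

/-- Under Frobenius' condition, a Sylow `p`-subgroup controls its own fusion. -/
theorem exists_mem_sylow_conj_eq (h : FrobeniusCondition p (⊤ : Subgroup G)) (P : Sylow p G)
    {x g : G} (hx : x ∈ P) (hgx : g * x * g⁻¹ ∈ P) : ∃ s ∈ P, g * x * g⁻¹ = s * x * s⁻¹ := by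
  have hp := Fact.out (p := p.Prime)
  obtain ⟨c, hc, e⟩ := h.exists_mem_centralizer_smul_eq P (g⁻¹ • P)
  have hxc : c * x * c⁻¹ = x := by
    rw [mul_inv_eq_iff_eq_mul]
    refine (mem_centralizer_iff.1 hc x ⟨hx, ?_⟩).symm
    change x ∈ ((g⁻¹ • P : Sylow p G) : Subgroup G)
    rw [Sylow.coe_subgroup_smul, Subgroup.mem_pointwise_smul_iff_inv_smul_mem]
    simpa [MulAut.smul_def] using (show g * x * g⁻¹ ∈ (P : Subgroup G) from hgx)
  have hn : g * c ∈ normalizer (P : Set G) := by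
    rw [← Sylow.smul_eq_iff_mem_normalizer, mul_smul, e, smul_inv_smul]
  have hgc : g * x * g⁻¹ = (g * c) * x * (g * c)⁻¹ := by
    conv_lhs => rw [← hxc]
    group
  obtain ⟨u, hu, v, hv, huv, ⟨k, hk⟩, hvp⟩ := exists_mul_eq_of_prime hp (g * c)
  have hnz : zpowers (g * c) ≤ normalizer (P : Set G) := zpowers_le.2 hn
  have huP : u ∈ P := by
    have h1 : IsPGroup p (zpowers u) := by
      rw [IsPGroup.iff_card]
      obtain ⟨m, -, hm⟩ := (Nat.dvd_prime_pow hp).1 (orderOf_dvd_of_pow_eq_one hk)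
      exact ⟨m, by rw [Nat.card_zpowers, hm]⟩
    have h2 := h1.inf_normalizer_sylow P
    have : u ∈ zpowers u ⊓ normalizer (P : Set G) := ⟨mem_zpowers u, hnz hu⟩
    rw [h2] at this
    exact this.2
  have hvx : v * x = x * v := h P le_top P.2 v (mem_top _) (hnz hv) hvp x hx
  refine ⟨u, huP, ?_⟩
  rw [hgc, huv]
  calc u * v * x * (u * v)⁻¹ = u * (v * x) * v⁻¹ * u⁻¹ := by group
    _ = _ := by rw [hvx]; group

end FrobeniusCondition

namespace FrobeniusCondition

section Complement

variable {G G' : Type*} [Group G] [Group G'] [Finite G] {p : ℕ} [Fact p.Prime]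

/-- Frobenius' theorem on normal `p`-complements. -/
theorem exists_normal_complement (h : FrobeniusCondition p (⊤ : Subgroup G)) :
    ∃ K : Subgroup G, K.Normal ∧ ¬ p ∣ Nat.card K ∧ ∀ x : G, ¬ p ∣ orderOf x → x ∈ K := by
  have hp := Fact.out (p := p.Prime)
  set s : Set G := {x | ¬ p ∣ orderOf x} with hs
  set K := normalClosure s with hK
  have hsK : s ⊆ K := subset_normalClosure
  refine ⟨K, normalClosure_normal, ?_, hsK⟩
  let Q : Sylow p K := default
  have h1 : ∀ x : K, transferFocal (Q : Subgroup K) x = 1 := by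
    have hQ : IsPGroup p (K ⧸ (transferFocal (Q : Subgroup K)).ker) := by
      refine IsPGroup.of_injective (Q.2.to_quotient (focalSubgroupOf (Q : Subgroup K)))
        (QuotientGroup.kerLift _) (QuotientGroup.kerLift_injective _)
    have h2 : K ≤ (transferFocal (Q : Subgroup K)).ker.map K.subtype := by
      refine (closure_le _).2 ?_
      intro x hx
      obtain ⟨y, hy, hyx⟩ := Group.mem_conjugatesOfSet_iff.1 hx
      obtain ⟨g, rfl⟩ := isConj_iff.1 hyx
      have hx : ¬ p ∣ orderOf (g * y * g⁻¹) := by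
        have : orderOf (MulAut.conj g y) = orderOf y := MulEquiv.orderOf_eq _ _
        rw [MulAut.conj_apply] at this
        rw [this]; exact hy
      refine ⟨⟨_, hsK hx⟩, ?_, rfl⟩
      obtain ⟨k, hk⟩ := hQ (QuotientGroup.mk ⟨_, hsK hx⟩)
      rw [← QuotientGroup.mk_pow, QuotientGroup.eq_one_iff] at hk
      exact mem_of_pow_prime_pow_mem hp (by rwa [Subgroup.orderOf_mk]) hk
    intro x
    obtain ⟨y, hy, hyx⟩ := h2 x.2
    obtain rfl : y = x := Subtype.ext hyx
    exact hy
  have h3 : focalSubgroup (Q : Subgroup K) = Q := by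
    refine le_antisymm (focalSubgroup_le _) fun x hx => ?_
    obtain ⟨y, hy⟩ := transferFocal_surjective Q (QuotientGroup.mk ⟨x, hx⟩)
    rw [h1] at hy
    have := (QuotientGroup.eq_one_iff _).1 hy.symm
    exact this
  obtain ⟨P, hP⟩ := (Q.2.map K.subtype).exists_le_sylow
  have h4 : ∀ n, (Q : Subgroup K).map K.subtype ≤ (P : Subgroup G).lowerCentralSeries n := by
    intro n
    induction n with
    | zero => exact hP
    | succ n ih =>
      rw [← h3, focalSubgroup_def, MonoidHom.map_closure, closure_le]
      rintro _ ⟨_, ⟨hz, x, hx, u, rfl⟩, rfl⟩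
      have hx' : (x : G) ∈ P := hP ⟨x, hx, rfl⟩
      have hz' : (x : G) * u * (x : G)⁻¹ * (u : G)⁻¹ ∈ P := hP ⟨_, hz, rfl⟩
      obtain ⟨t, ht, e⟩ := h.exists_mem_sylow_conj_eq P (x := (x : G)⁻¹) (g := u) (inv_mem hx') (by
        have := mul_mem (inv_mem hx') hz'
        simpa [mul_assoc] using this)
      have h5 : K.subtype ⁅x, u⁆ = ⁅(x : G), t⁆ := by
        rw [map_commutatorElement, commutatorElement_def, commutatorElement_def]
        simp only [mul_assoc, subtype_apply] at e ⊢
        rw [e]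
      rw [h5]
      exact commutator_mem_commutator (ih ⟨x, hx, rfl⟩) ht
  have hPn : Group.IsNilpotent (P : Subgroup G) := P.2.isNilpotent
  obtain ⟨n, hn⟩ := (isNilpotent_iff_lowerCentralSeries _).1 hPn
  have h6 : (Q : Subgroup K) = ⊥ := by
    have := h4 n
    rw [hn, le_bot_iff, map_eq_bot_iff_of_injective _ K.subtype_injective] at this
    exact this
  have h7 := Q.not_dvd_index
  rwa [h6, index_bot] at h7

theorem map_top (h : FrobeniusCondition p (⊤ : Subgroup G)) {f : G →* G'}
    (hf : Function.Surjective f) : FrobeniusCondition p (⊤ : Subgroup G') := by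
  have hp := Fact.out (p := p.Prime)
  have : Finite G' := Finite.of_surjective f hf
  obtain ⟨K, hK, hKp, hKx⟩ := h.exists_normal_complement
  have := hK.map f hf
  refine of_normal (K.map f) (fun hd => hKp (hd.trans (card_map_dvd K f))) fun x hx => ?_
  obtain ⟨x, rfl⟩ := hf x
  obtain ⟨k, hk⟩ := exists_not_dvd_orderOf_pow hp x
  exact mem_of_pow_prime_pow_mem hp hx (k := k) (by
    rw [← map_pow]; exact mem_map_of_mem f (hKx _ hk))

theorem map_of_finite (f : G →* G') {H : Subgroup G} (h : FrobeniusCondition p H) :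
    FrobeniusCondition p (H.map f) := by
  rw [← top_iff] at h ⊢
  exact h.map_top (f.subgroupMap_surjective H)

end Complement

end FrobeniusCondition

section CommutingAutomorphisms

variable {T : Type*} [CommGroup T] {p : ℕ}

theorem MulAut.apply_prod_range_pow {δ : MulAut T} (hδ : δ ^ p = 1) (y : T) :
    δ (∏ i ∈ Finset.range p, (δ ^ i) y) = ∏ i ∈ Finset.range p, (δ ^ i) y := by
  rw [map_prod]
  have h := Finset.prod_range_succ' (fun i => (δ ^ i) y) p
  rw [Finset.prod_range_succ, hδ, pow_zero] at h
  rw [mul_right_cancel h]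
  exact Finset.prod_congr rfl fun i _ => by rw [pow_succ']; rfl

/-- If two commuting automorphisms `α`, `β` of exponent `p` are such that the fixed points of `α`
and of all the `α ^ i * β` lie in a subgroup centralised by `β`, then so do all `p`-th powers. -/
theorem MulAut.pow_mem_of_fixedPoints (hp : p.Prime) {α β : MulAut T} (hαβ : Commute α β)
    (hα : α ^ p = 1) (hβ : β ^ p = 1) {S C : Subgroup T} (hSα : ∀ t ∈ S, α t ∈ S)
    (hSβ : ∀ t ∈ S, β t ∈ S) (h1 : ∀ t ∈ S, α t = t → t ∈ C)
    (h2 : ∀ i, ∀ t ∈ S, (α ^ i * β) t = t → t ∈ C) (hC : ∀ c ∈ C, β c = c) {y : T} (hy : y ∈ S) :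
    y ^ p ∈ C := by
  have pow_mem_S : ∀ δ : MulAut T, (∀ t ∈ S, δ t ∈ S) → ∀ n : ℕ, ∀ t ∈ S, (δ ^ n) t ∈ S := by
    intro δ hδ n
    induction n with
    | zero => simp
    | succ n ih =>
      intro t ht
      rw [pow_succ']
      exact hδ _ (ih t ht)
  have hE : ∏ i ∈ Finset.range p, ∏ j ∈ Finset.range p, ((α ^ i * β) ^ j) y ∈ C := by
    refine prod_mem fun i _ => h2 i _ (prod_mem fun j _ => pow_mem_S (α ^ i * β)
      (fun t ht => pow_mem_S α hSα i (β t) (hSβ t ht)) j y hy) (MulAut.apply_prod_range_pow ?_ y)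
    rw [(hαβ.pow_left i).mul_pow, hβ, mul_one, ← pow_mul, mul_comm, pow_mul, hα, one_pow]
  have hβC : ∀ j : ℕ, ∀ c ∈ C, (β ^ j) c = c := by
    intro j
    induction j with
    | zero => simp
    | succ n ih =>
      intro c hc
      rw [pow_succ', MulAut.mul_apply, ih c hc, hC c hc]
  have h3 : ∏ i ∈ Finset.range p, ((α ^ i * β) ^ 0) y = y ^ p := by simp
  obtain ⟨q, hq⟩ := Nat.exists_eq_add_one.2 hp.pos
  rw [Finset.prod_comm, hq, Finset.prod_range_succ', ← hq, h3] at hE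
  refine (mul_mem_cancel_left (prod_mem fun j hj => ?_)).1 hE
  have hj1 : j + 1 < p := by
    have := Finset.mem_range.1 hj
    omega
  have h4 : ∏ i ∈ Finset.range p, ((α ^ (j + 1)) ^ i) y ∈ C := by
    refine h1 _ (prod_mem fun i _ => pow_mem_S _ (pow_mem_S α hSα _) i y hy) ?_
    have h5 := MulAut.apply_prod_range_pow (δ := α ^ (j + 1)) (p := p)
      (by rw [← pow_mul, mul_comm, pow_mul, hα, one_pow]) y
    have h6 : α ∈ zpowers (α ^ (j + 1)) := by
      refine mem_zpowers_pow_iff.2 ?_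
      refine Nat.Coprime.coprime_dvd_right (orderOf_dvd_of_pow_eq_one hα) ?_
      exact (hp.coprime_iff_not_dvd.2 (Nat.not_dvd_of_pos_of_lt j.succ_pos hj1)).symm
    have h7 : α ^ (j + 1) ∈ MulAction.stabilizer (MulAut T)
      (∏ i ∈ Finset.range p, ((α ^ (j + 1)) ^ i) y) := h5
    exact (zpowers_le.2 h7) h6
  have h8 : ∏ i ∈ Finset.range p, ((α ^ i * β) ^ (j + 1)) y =
      (β ^ (j + 1)) (∏ i ∈ Finset.range p, ((α ^ (j + 1)) ^ i) y) := by
    rw [map_prod]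
    refine Finset.prod_congr rfl fun i _ => ?_
    rw [(hαβ.pow_left i).mul_pow, ← MulAut.mul_apply, ← pow_mul, ← pow_mul, mul_comm i,
      (hαβ.pow_pow _ _).eq]
  rw [h8, hβC _ _ h4]
  exact h4

end CommutingAutomorphisms

section Transvections

variable {W : Type*} [AddCommGroup W] {p : ℕ}

theorem Module.End.mul_mul_eq_zero (hp : p.Prime) (hp2 : p ≠ 2) (hW : ∀ w : W, p • w = 0)
    {N x : Module.End ℤ W} (hN : N * N = 0) {u : W}
    (hv : ∀ w, N w ∈ AddSubgroup.zmultiples (N u))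
    (hx : x * ((1 + N) * x * (1 - N)) = (1 + N) * x * (1 - N) * x) : N * x * N = 0 := by
  have h1 : 2 * (x * N * x) = N * x * x + x * x * N + x * N * x * N - N * x * N * x := by
    have : x * ((1 + N) * x * (1 - N)) - (1 + N) * x * (1 - N) * x = 2 * (x * N * x) -
        (N * x * x + x * x * N + x * N * x * N - N * x * N * x) := by noncomm_ring
    rwa [hx, sub_self, eq_comm, sub_eq_zero] at this
  have hNN : ∀ w, N (N w) = 0 := fun w => LinearMap.congr_fun hN w
  obtain ⟨c, hc⟩ := AddSubgroup.mem_zmultiples_iff.1 (hv (x (N u)))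
  have h2 : (2 * c) • x (N u) = N (x (x (N u))) - c • N (x (N u)) := by
    have := LinearMap.congr_fun h1 (N u)
    simp only [two_mul, LinearMap.add_apply, LinearMap.sub_apply, Module.End.mul_apply, hNN,
      map_zero, add_zero, ← hc, map_zsmul] at this
    rw [two_mul, add_smul, this, hc]
  have h3 : N (x (N u)) = 0 := by
    by_cases hpc : (p : ℤ) ∣ c
    · obtain ⟨d, rfl⟩ := hpc
      rw [← hc, mul_comm, mul_smul, natCast_zsmul, hW, smul_zero]
    · have hcop : IsCoprime (2 * c) (p : ℤ) := by
        have hpp := Nat.prime_iff_prime_int.1 hp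
        rw [isCoprime_comm, hpp.irreducible.coprime_iff_not_dvd, hpp.dvd_mul, not_or]
        refine ⟨fun h => ?_, hpc⟩
        have := (Nat.prime_dvd_prime_iff_eq hp Nat.prime_two).1 (by exact_mod_cast h)
        exact hp2 this
      obtain ⟨r, s, hrs⟩ := hcop
      have h4 : x (N u) = r • (N (x (x (N u))) - c • N (x (N u))) := by
        rw [← h2, ← mul_smul]
        calc x (N u) = (r * (2 * c) + s * p) • x (N u) := by rw [hrs, one_smul]
          _ = _ := by rw [add_smul, mul_smul s, natCast_zsmul, hW, smul_zero, add_zero]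
      rw [h4, map_zsmul, map_sub, map_zsmul, hNN, hNN, smul_zero, sub_zero, smul_zero]
  ext w
  obtain ⟨d, hd⟩ := AddSubgroup.mem_zmultiples_iff.1 (hv w)
  change N (x (N w)) = 0
  rw [← hd, map_zsmul, map_zsmul, h3, smul_zero]

/-- An automorphism of order `p` of an elementary abelian `p`-group that fixes a hyperplane is a
transvection. -/
theorem Module.End.sub_one_mul_self_eq_zero [Finite W] (hp : p.Prime)
    (hW : ∀ w : W, p • w = 0) {a : Module.End ℤ W} (ha : a ^ p = 1)
    (hc : Nat.card W ≤ p * Nat.card (LinearMap.ker (a - 1))) :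
    (a - 1) * (a - 1) = 0 ∧ ∃ u, ∀ w, (a - 1) w ∈ AddSubgroup.zmultiples ((a - 1) u) := by
  set N := a - 1 with hN
  have hNp : N ^ p = 0 := by
    obtain ⟨r, hr⟩ := (Commute.one_right N).exists_add_pow_prime_eq hp
    rw [hN, sub_add_cancel, ha, ← hN, one_pow] at hr
    have hp0 : (p : Module.End ℤ W) = 0 := by
      ext w
      simpa using hW w
    rw [hp0] at hr
    simpa using hr
  have hcard : Nat.card (LinearMap.range N) ≤ p := by
    have h1 := Submodule.card_eq_card_quotient_mul_card (LinearMap.ker N)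
    rw [Nat.card_congr N.quotKerEquivRange.toEquiv] at h1
    rw [h1, mul_comm] at hc
    exact Nat.le_of_mul_le_mul_right hc Nat.card_pos
  by_cases h0 : N = 0
  · exact ⟨by rw [h0, zero_mul], 0, fun w => by rw [h0]; exact zero_mem _⟩
  have key : ∀ u, N u ≠ 0 → ∀ w, N w ∈ AddSubgroup.zmultiples (N u) := by
    intro u hu w
    have h1 : AddSubgroup.zmultiples (N u) ≤ (LinearMap.range N).toAddSubgroup := by
      rw [AddSubgroup.zmultiples_le]
      exact ⟨u, rfl⟩
    have h2 : Nat.card (AddSubgroup.zmultiples (N u)) = p := by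
      rw [Nat.card_zmultiples]
      have := Fact.mk hp
      exact addOrderOf_eq_prime (hW _) hu
    have h3 : AddSubgroup.zmultiples (N u) = (LinearMap.range N).toAddSubgroup :=
      SetLike.coe_injective (Set.eq_of_subset_of_ncard_le h1 (by
        rw [← Nat.card_coe_set_eq, ← Nat.card_coe_set_eq]
        exact hcard.trans h2.ge))
    rw [h3]
    exact ⟨w, rfl⟩
  obtain ⟨u, hu⟩ := DFunLike.ne_iff.1 h0
  refine ⟨?_, u, key u hu⟩
  by_contra hNN
  obtain ⟨w, hw⟩ := DFunLike.ne_iff.1 hNN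
  obtain ⟨d, hd⟩ := AddSubgroup.mem_zmultiples_iff.1 (key (N w) hw w)
  have h4 : ∀ n : ℕ, N w = d ^ n • (N ^ n) (N w) := by
    intro n
    induction n with
    | zero => simp
    | succ n ih =>
      rw [pow_succ, mul_smul, pow_succ, Module.End.mul_apply, ← map_zsmul _ d, hd]
      exact ih
  have h5 := h4 p
  rw [hNp, LinearMap.zero_apply, smul_zero] at h5
  exact hw (by rw [Module.End.mul_apply, h5, map_zero]; rfl)

theorem Module.End.commute_mul_mul [Finite W] (hp : p.Prime) (hp2 : p ≠ 2)
    (hW : ∀ w : W, p • w = 0) {a b x y : Module.End ℤ W} (hab : a * b = 1)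
    (hxy : x * y = 1) (hyx : y * x = 1) (ha : a ^ p = 1)
    (hc : Nat.card W ≤ p * Nat.card (LinearMap.ker (a - 1)))
    (hx : x * (a * x * b) = a * x * b * x) : Commute a (x * a * y) := by
  obtain ⟨hN, u, hu⟩ := sub_one_mul_self_eq_zero hp hW ha hc
  obtain ⟨N, rfl⟩ : ∃ N, a = 1 + N := ⟨a - 1, by abel⟩
  rw [add_sub_cancel_left] at hN hu
  obtain rfl : b = 1 - N := by
    calc b = (1 - N * N) * b := by rw [hN, sub_zero, one_mul]
      _ = (1 - N) * ((1 + N) * b) := by noncomm_ring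
      _ = _ := by rw [hab, mul_one]
  have hba : (1 - N) * (1 + N) = 1 := by
    calc (1 - N) * (1 + N) = 1 - N * N := by noncomm_ring
      _ = 1 := by rw [hN, sub_zero]
  let ux : (Module.End ℤ W)ˣ := ⟨x, y, hxy, hyx⟩
  let ua : (Module.End ℤ W)ˣ := ⟨1 + N, 1 - N, hab, hba⟩
  have hux : Commute ux (ua * ux * ua⁻¹) := Units.ext hx
  have huy := hux.inv_inv
  rw [mul_inv_rev, mul_inv_rev, inv_inv, ← mul_assoc] at huy
  have hNx : N * x * N = 0 := mul_mul_eq_zero hp hp2 hW hN hu hx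
  have hNy : N * y * N = 0 := mul_mul_eq_zero hp hp2 hW hN hu (congrArg Units.val huy)
  have h1 : x * (1 + N) * y = 1 + x * N * y := by rw [mul_add, mul_one, add_mul, hxy]
  have h2 : N * (x * N * y) = x * N * y * N := by
    calc N * (x * N * y) = N * x * N * y := by noncomm_ring
      _ = x * (N * y * N) := by rw [hNx, hNy, zero_mul, mul_zero]
      _ = _ := by noncomm_ring
  rw [h1]
  exact ((Commute.one_left _).add_left ((Commute.one_right _).add_right h2))

end Transvections

section Coprime

open scoped Pointwise

variable {Γ : Type*} [Group Γ] [Finite Γ] {p : ℕ}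

theorem Subgroup.exists_lt_eq_sup_zpowers (hp : p.Prime) {A Q : Subgroup Γ}
    (hA : ∀ a ∈ A, ∀ b ∈ A, a * b = b * a) (hAp : ∀ a ∈ A, a ^ p = 1)
    (hQ : ∀ x ∈ Q, ∀ y ∈ Q, x * y = y * x) (hQp : ¬ p ∣ Nat.card Q)
    (hAQ : A ≤ normalizer (Q : Set Γ)) (hf : ∀ a ∈ A, (∀ x ∈ Q, a * x = x * a) → a = 1)
    (h1 : A ≠ ⊥) : ∃ B < A, ∃ a ∈ A, a ∉ B ∧ A = B ⊔ zpowers a ∧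
      ∃ x ∈ Q, (∀ b ∈ B, b * x = x * b) ∧ a * x ≠ x * a := by
  let s : Set (Subgroup Γ) := {B | B ≤ A ∧ ∃ x ∈ Q, x ∈ centralizer (B : Set Γ) ∧
    x ∉ centralizer (A : Set Γ)}
  have hs : s.Nonempty := by
    refine ⟨⊥, bot_le, ?_⟩
    by_contra! h
    refine h1 ((eq_bot_iff_forall _).2 fun a ha => hf a ha fun x hx => ?_)
    refine mem_centralizer_iff.1 (h x hx ?_) a ha
    rw [mem_centralizer_iff]
    rintro y hy
    rw [mem_bot.1 hy, one_mul, mul_one]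
  obtain ⟨B, ⟨hBA, x, hxQ, hxB, hxA⟩, hmax⟩ := (Set.toFinite s).exists_maximal hs
  have hBA' : B < A := lt_of_le_of_ne hBA fun e => hxA (e ▸ hxB)
  have key : ∀ c ∈ A, c ∉ B → ∀ t ∈ Q, t ∈ centralizer (B : Set Γ) → c * t = t * c →
      t ∈ centralizer (A : Set Γ) := by
    intro c hcA hcB t ht htB hct
    by_contra htA
    have h2 : B ⊔ zpowers c ≤ centralizer {t} := by
      rw [sup_le_iff, zpowers_le]
      exact ⟨fun b hb => mem_centralizer_singleton_iff.2 (mem_centralizer_iff.1 htB b hb),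
        mem_centralizer_singleton_iff.2 hct⟩
    have h3 : B ⊔ zpowers c ∈ s := ⟨sup_le hBA (zpowers_le.2 hcA), t, ht,
      mem_centralizer_iff.2 fun y hy => mem_centralizer_singleton_iff.1 (h2 hy), htA⟩
    exact hcB (hmax h3 le_sup_left (mem_sup_right (mem_zpowers c)))
  obtain ⟨a, haA, haB⟩ := SetLike.exists_of_lt hBA'
  have heq : A = B ⊔ zpowers a := by
    by_contra hne
    have hlt : B ⊔ zpowers a < A :=
      lt_of_le_of_ne (sup_le hBA (zpowers_le.2 haA)) (Ne.symm hne)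
    obtain ⟨b, hbA, hbB⟩ := SetLike.exists_of_lt hlt
    let _ : CommGroup Q := { (inferInstance : Group Q) with
      mul_comm := fun x y => Subtype.ext (hQ x x.2 y y.2) }
    let f := Q.normalizerMonoidHom
    let α := f ⟨a, hAQ haA⟩
    let β := f ⟨b, hAQ hbA⟩
    have hα : ∀ t : Q, ((α t : Q) : Γ) = a * t * a⁻¹ := fun t => rfl
    have hβ : ∀ t : Q, ((β t : Q) : Γ) = b * t * b⁻¹ := fun t => rfl
    have hinv : ∀ c ∈ A, ∀ t ∈ centralizer (B : Set Γ), c * t * c⁻¹ ∈ centralizer (B : Set Γ) := by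
      intro c hc t ht
      have : c ∈ centralizer (B : Set Γ) :=
        mem_centralizer_iff.2 fun y hy => hA y (hBA hy) c hc
      exact mul_mem (mul_mem this ht) (inv_mem this)
    have h4 := MulAut.pow_mem_of_fixedPoints hp (α := α) (β := β)
      (S := (centralizer (B : Set Γ)).subgroupOf Q) (C := (centralizer (A : Set Γ)).subgroupOf Q)
      (y := ⟨x, hxQ⟩)
      (by rw [commute_iff_eq, ← map_mul, ← map_mul]; congr 1; exact Subtype.ext (hA a haA b hbA))
      (by rw [← map_pow, ← map_one f]; congr 1; exact Subtype.ext (hAp a haA))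
      (by rw [← map_pow, ← map_one f]; congr 1; exact Subtype.ext (hAp b hbA))
      (fun t ht => hinv a haA t ht) (fun t ht => hinv b hbA t ht)
      (fun t ht hat => key a haA haB t t.2 ht (by
        rw [← mul_inv_eq_iff_eq_mul, ← hα, hat]))
      (fun i t ht hat => by
        refine key (a ^ i * b) (mul_mem (pow_mem haA i) hbA) (fun h => hbB ?_) t t.2 ht ?_
        · exact (mul_mem_cancel_left (mem_sup_right (pow_mem (mem_zpowers a) i))).1
            (mem_sup_left h)
        · have : α ^ i * β = f (⟨a, hAQ haA⟩ ^ i * ⟨b, hAQ hbA⟩) := by rw [map_mul, map_pow]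
          rw [this] at hat
          rw [← mul_inv_eq_iff_eq_mul]
          exact congrArg Subtype.val hat)
      (fun c hc => Subtype.ext (by
        rw [hβ, mul_inv_eq_iff_eq_mul]
        exact mem_centralizer_iff.1 hc b hbA))
      hxB
    refine hxA (mem_of_pow_prime_pow_mem (k := 1) hp (fun h => hQp (h.trans ?_)) (by
      rw [pow_one]; exact h4))
    exact Q.orderOf_dvd_natCard hxQ
  refine ⟨B, hBA', a, haA, haB, heq, x, hxQ, fun b hb => mem_centralizer_iff.1 hxB b hb, ?_⟩
  exact fun h => hxA (key a haA haB x hxQ hxB h)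

variable {V : Type*} [AddCommGroup V] [Finite V]

theorem IsPGroup.exists_ne_zero_smul_eq {B : Type*} [Group B] [DistribMulAction B V]
    [Fact p.Prime] (hB : IsPGroup p B) (hV : ∀ v : V, p • v = 0) {K : AddSubgroup V} (hK : K ≠ ⊥)
    (hBK : ∀ b : B, ∀ k ∈ K, b • k ∈ K) : ∃ k ∈ K, k ≠ 0 ∧ ∀ b : B, b • k = k := by
  let _ : MulAction B K :=
    { smul := fun b k => ⟨b • (k : V), hBK b k k.2⟩
      one_smul := fun k => Subtype.ext (one_smul B (k : V))
      mul_smul := fun b c k => Subtype.ext (mul_smul b c (k : V)) }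
  have hcoe : ∀ (b : B) (k : K), ((b • k : K) : V) = b • (k : V) := fun b k => rfl
  obtain ⟨k, hk0⟩ := AddSubgroup.ne_bot_iff_exists_ne_zero.1 hK
  have h1 : p ∣ Nat.card K := by
    rw [← addOrderOf_eq_prime (Subtype.ext (hV k)) hk0]
    exact addOrderOf_dvd_natCard k
  obtain ⟨b, hb, hb0⟩ := hB.exists_fixed_point_of_prime_dvd_card_of_fixed_point K h1 (a := 0)
    (fun b => Subtype.ext (by rw [hcoe, AddSubgroup.coe_zero, smul_zero]))
  exact ⟨b, b.2, fun h => hb0 (Subtype.ext h.symm), fun c => congrArg Subtype.val (hb c)⟩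

variable [DistribMulAction Γ V]

omit [Finite Γ] in
/-- A special case of Thompson's `P × Q`-lemma. -/
theorem smul_eq_of_forall_fixedPoints [Fact p.Prime] (hV : ∀ v : V, p • v = 0) {B : Subgroup Γ}
    (hB : IsPGroup p B) {z : Γ} (hz : ¬ p ∣ orderOf z) (hzB : ∀ b ∈ B, Commute z b)
    (h : ∀ v ∈ FixedPoints.addSubgroup B V, z • v = v) (v : V) : z • v = v := by
  have hp := Fact.out (p := p.Prime)
  let π : V →+ V := ∑ i ∈ Finset.range (orderOf z), DistribSMul.toAddMonoidHom V (z ^ i)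
  have hπ : ∀ v, π v = ∑ i ∈ Finset.range (orderOf z), z ^ i • v := fun v => by
    simp [π, AddMonoidHom.finsetSum_apply]
  have hinj : π.ker = ⊥ := by
    by_contra hK
    obtain ⟨k, hk, hk0, hkB⟩ := hB.exists_ne_zero_smul_eq hV hK fun b k hk => by
      rw [AddMonoidHom.mem_ker, hπ] at hk ⊢
      rw [← smul_zero b, ← hk, Finset.smul_sum]
      refine Finset.sum_congr rfl fun i _ => ?_
      rw [Subgroup.smul_def, Subgroup.smul_def, ← mul_smul, ← mul_smul, ((hzB b b.2).pow_left i).eq]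
    have h1 := h k hkB
    have h2 : ∀ i : ℕ, z ^ i • k = k := fun i => by
      induction i with
      | zero => simp
      | succ n ih => rw [pow_succ, mul_smul, h1, ih]
    rw [AddMonoidHom.mem_ker, hπ] at hk
    simp only [h2, Finset.sum_const, Finset.card_range] at hk
    have h3 := addOrderOf_eq_prime (hV k) hk0
    exact hz (h3 ▸ addOrderOf_dvd_of_nsmul_eq_zero hk)
  refine (AddMonoidHom.ker_eq_bot_iff π).1 hinj ?_
  have h4 := Finset.sum_range_succ' (fun i => z ^ i • v) (orderOf z)
  rw [Finset.sum_range_succ, pow_orderOf_eq_one, pow_zero] at h4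
  rw [hπ, hπ, add_right_cancel h4]
  exact Finset.sum_congr rfl fun i _ => by rw [← mul_smul, pow_succ]

/-- The action of the centralizer of `B` on the fixed points of `B`. -/
def centralizerFixedPointsEnd (B : Subgroup Γ) (V : Type*) [AddCommGroup V]
    [DistribMulAction Γ V] : centralizer (B : Set Γ) →*
      Module.End ℤ (FixedPoints.addSubgroup B V).toIntSubmodule where
  toFun c := (DistribMulAction.toModuleEnd ℤ V (c : Γ)).restrict fun v hv b => by
    have h : (b : Γ) * c = c * b := mem_centralizer_iff.1 c.2 b b.2
    change (b : Γ) • (c : Γ) • v = (c : Γ) • v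
    rw [← mul_smul, h, mul_smul]
    exact congrArg _ (hv b)
  map_one' := by
    ext v
    exact one_smul Γ (v : V)
  map_mul' c d := by
    ext v
    exact mul_smul (c : Γ) (d : Γ) (v : V)

omit [Finite Γ] in
theorem mul_comm_of_card_fixedPoints_le [FaithfulSMul Γ V] [Fact p.Prime] (hp2 : p ≠ 2)
    (hV : ∀ v : V, p • v = 0) {B : Subgroup Γ} (hB : IsPGroup p B) {a x : Γ}
    (ha : a ∈ centralizer (B : Set Γ)) (hx : x ∈ centralizer (B : Set Γ)) (hap : a ^ p = 1)
    (hax : Commute x (a * x * a⁻¹)) (hz : ¬ p ∣ orderOf (a⁻¹ * (x * a * x⁻¹)))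
    (hc : Nat.card (FixedPoints.addSubgroup B V) ≤
      p * Nat.card (FixedPoints.addSubgroup (B ⊔ zpowers a : Subgroup Γ) V)) :
    a * x = x * a := by
  have hp := Fact.out (p := p.Prime)
  let C := centralizer (B : Set Γ)
  let ρ := centralizerFixedPointsEnd B V
  have hρ : ∀ (c : C) (w : (FixedPoints.addSubgroup B V).toIntSubmodule),
    ((ρ c w : (FixedPoints.addSubgroup B V).toIntSubmodule) : V) = (c : Γ) • (w : V) :=
    fun c w => rfl
  let a' : C := ⟨a, ha⟩
  let x' : C := ⟨x, hx⟩
  have ha' : a' ^ p = 1 := Subtype.ext hap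
  have hcomm : Commute (ρ a') (ρ x' * ρ a' * ρ x'⁻¹) := by
    refine Module.End.commute_mul_mul hp hp2 (fun w => Subtype.ext (hV w)) (b := ρ a'⁻¹)
      (by rw [← map_mul, mul_inv_cancel, map_one]) (by rw [← map_mul, mul_inv_cancel, map_one])
      (by rw [← map_mul, inv_mul_cancel, map_one]) (by rw [← map_pow, ha', map_one])
      (hc.trans (Nat.mul_le_mul_left p ?_))
      (by
        rw [← map_mul, ← map_mul, ← map_mul, ← map_mul]
        exact congrArg ρ (Subtype.ext hax))
    have hle : FixedPoints.addSubgroup (B ⊔ zpowers a : Subgroup Γ) V ≤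
        FixedPoints.addSubgroup B V := fun v hv b => hv ⟨b, mem_sup_left b.2⟩
    refine Nat.card_le_card_of_injective
      (fun v => ⟨⟨v, hle v.2⟩, ?_⟩) fun v w h => Subtype.ext ?_
    · rw [LinearMap.mem_ker, LinearMap.sub_apply, sub_eq_zero]
      exact Subtype.ext (v.2 ⟨a, mem_sup_right (mem_zpowers a)⟩)
    · exact congrArg (fun t : LinearMap.ker (ρ a' - 1) => (t : V)) h
  have hcomm' : Commute (ρ a'⁻¹) (ρ (x' * a' * x'⁻¹)) := by
    rw [map_mul, map_mul]
    have h1 : ρ a' * ρ a'⁻¹ = 1 := by rw [← map_mul, mul_inv_cancel, map_one]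
    have h2 : ρ a'⁻¹ * ρ a' = 1 := by rw [← map_mul, inv_mul_cancel, map_one]
    exact Commute.units_inv_left (u := ⟨ρ a', ρ a'⁻¹, h1, h2⟩) hcomm
  set z := a⁻¹ * (x * a * x⁻¹) with hzdef
  have hzp : ρ (a'⁻¹ * (x' * a' * x'⁻¹)) ^ p = 1 := by
    have h3 : (x' * a' * x'⁻¹) ^ p = 1 := by rw [conj_pow, ha', mul_one, mul_inv_cancel]
    rw [map_mul, hcomm'.mul_pow, ← map_pow, ← map_pow, inv_pow, ha', h3, inv_one, map_one, mul_one]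
  have hzC : z ∈ C := mul_mem (inv_mem ha) (mul_mem (mul_mem hx ha) (inv_mem hx))
  have hzV : ∀ v : V, z • v = v := by
    refine smul_eq_of_forall_fixedPoints hV hB hz
      (fun b hb => (mem_centralizer_iff.1 hzC b hb).symm) fun v hv => ?_
    have h5 : z ^ p ∈ MulAction.stabilizer Γ v := by
      have := LinearMap.congr_fun hzp ⟨v, hv⟩
      rw [← map_pow] at this
      exact congrArg Subtype.val this
    exact mem_of_pow_prime_pow_mem (k := 1) hp hz (by rwa [pow_one])
  have hz1 : z = 1 := eq_of_smul_eq_smul (α := V) fun v => by rw [hzV, one_smul]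
  rw [hzdef, inv_mul_eq_one, eq_mul_inv_iff_mul_eq] at hz1
  exact hz1

/-- The key inequality: an elementary abelian `p`-group acting faithfully on an abelian `p'`-group
which acts faithfully on `V` is far from being an offender on `V`. -/
theorem card_sq_mul_card_fixedPoints_le [FaithfulSMul Γ V] [Fact p.Prime] (hp2 : p ≠ 2)
    (hV : ∀ v : V, p • v = 0) {Q : Subgroup Γ} (hQ : ∀ x ∈ Q, ∀ y ∈ Q, x * y = y * x)
    (hQp : ¬ p ∣ Nat.card Q) (A : Subgroup Γ)
    (hA : ∀ a ∈ A, ∀ b ∈ A, a * b = b * a) (hAp : ∀ a ∈ A, a ^ p = 1)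
    (hAQ : A ≤ normalizer (Q : Set Γ)) (hf : ∀ a ∈ A, (∀ x ∈ Q, a * x = x * a) → a = 1) :
    Nat.card A ^ 2 * Nat.card (FixedPoints.addSubgroup A V) ≤ Nat.card V := by
  have hp := Fact.out (p := p.Prime)
  induction hn : Nat.card A using Nat.strong_induction_on generalizing A with
  | _ n ih =>
  subst hn
  by_cases h1 : A = ⊥
  · subst h1
    rw [card_bot, one_pow, one_mul]
    exact Nat.card_le_card_of_injective _ Subtype.val_injective
  obtain ⟨B, hBA, a, haA, haB, heq, x, hxQ, hxB, hax⟩ :=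
    exists_lt_eq_sup_zpowers hp hA hAp hQ hQp hAQ hf h1
  have hlt : Nat.card B < Nat.card A := Set.ncard_lt_ncard (SetLike.coe_ssubset_coe.2 hBA)
  have h2 := ih _ hlt B (fun b hb c hc => hA b (hBA.le hb) c (hBA.le hc))
    (fun b hb => hAp b (hBA.le hb)) (hBA.le.trans hAQ) (fun b hb => hf b (hBA.le hb)) rfl
  have hBp : IsPGroup p B := fun b => ⟨1, Subtype.ext (by
    rw [pow_one]; exact hAp b (hBA.le b.2))⟩
  have hcA : Nat.card A ≤ Nat.card B * p := by
    have h3 : Nat.card (zpowers a) ≤ p := by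
      rw [Nat.card_zpowers]
      exact Nat.le_of_dvd hp.pos (orderOf_dvd_of_pow_eq_one (hAp a haA))
    have h5 : (A : Set Γ) = (B : Set Γ) * (zpowers a : Set Γ) := by
      rw [← coe_mul_of_right_le_normalizer_left B (zpowers a), ← heq]
      exact zpowers_le.2 (centralizer_le_normalizer _ (mem_centralizer_iff.2
        fun b hb => hA b (hBA.le hb) a haA))
    calc Nat.card A = Nat.card ((B : Set Γ) * (zpowers a : Set Γ) : Set Γ) := by
          rw [← h5]; rfl
      _ ≤ Nat.card B * Nat.card (zpowers a) := Set.natCard_mul_le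
      _ ≤ _ := Nat.mul_le_mul_left _ h3
  have h4 : ¬ Nat.card (FixedPoints.addSubgroup B V) ≤
      p * Nat.card (FixedPoints.addSubgroup A V) := by
    intro hc
    rw [heq] at hc
    have hn := mem_normalizer_iff.1 (hAQ haA)
    have hn' := mem_normalizer_iff.1 (inv_mem (hAQ haA))
    refine hax (mul_comm_of_card_fixedPoints_le hp2 hV hBp
      (mem_centralizer_iff.2 fun b hb => hA b (hBA.le hb) a haA) (mem_centralizer_iff.2 hxB)
      (hAp a haA) (hQ x hxQ _ ((hn x).1 hxQ)) (fun h => hQp (h.trans ?_)) hc)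
    refine Q.orderOf_dvd_natCard ?_
    have h5 : a⁻¹ * (x * a * x⁻¹) = a⁻¹ * x * a⁻¹⁻¹ * x⁻¹ := by group
    rw [h5]
    exact mul_mem ((hn' x).1 hxQ) (inv_mem hxQ)
  have h6 : p ^ 2 * Nat.card (FixedPoints.addSubgroup A V) ≤
      Nat.card (FixedPoints.addSubgroup B V) := by
    have hpow : ∀ K : AddSubgroup V, ∃ k, Nat.card K = p ^ k := fun K => by
      refine IsPGroup.exists_card_eq (G := Multiplicative K) fun k => ⟨1, ?_⟩
      have h7 : p • Multiplicative.toAdd k = 0 := Subtype.ext (hV _)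
      rw [pow_one]
      exact h7
    obtain ⟨i, hi⟩ := hpow (FixedPoints.addSubgroup A V)
    obtain ⟨j, hj⟩ := hpow (FixedPoints.addSubgroup B V)
    rw [hi, hj, ← pow_succ', Nat.pow_le_pow_iff_right hp.one_lt] at h4
    rw [hi, hj, ← pow_add]
    exact Nat.pow_le_pow_right hp.pos (by omega)
  calc Nat.card A ^ 2 * Nat.card (FixedPoints.addSubgroup A V)
      ≤ (Nat.card B * p) ^ 2 * Nat.card (FixedPoints.addSubgroup A V) := by gcongr
    _ = Nat.card B ^ 2 * (p ^ 2 * Nat.card (FixedPoints.addSubgroup A V)) := by ring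
    _ ≤ Nat.card B ^ 2 * Nat.card (FixedPoints.addSubgroup B V) := by gcongr
    _ ≤ _ := h2

end Coprime

/-- `X` is a characteristic subgroup of the subgroup `S`. -/
def Subgroup.IsCharIn {G : Type*} [Group G] (X S : Subgroup G) : Prop :=
  X ≤ S ∧ ∀ (φ : S ≃* S) (x : S), (x : G) ∈ X → (φ x : G) ∈ X

namespace Subgroup.IsCharIn

variable {G G' : Type*} [Group G] [Group G'] {X S : Subgroup G}

theorem normalizer_le (h : X.IsCharIn S) : normalizer (S : Set G) ≤ normalizer (X : Set G) := by
  have key : ∀ g ∈ normalizer (S : Set G), ∀ x ∈ X, g * x * g⁻¹ ∈ X := fun g hg x hx =>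
    h.2 (S.normalizerMonoidHom ⟨g, hg⟩) ⟨x, h.1 hx⟩ hx
  intro g hg
  refine mem_normalizer_iff.2 fun x => ⟨key g hg x, fun hx => ?_⟩
  have := key _ (inv_mem hg) _ hx
  simpa [mul_assoc] using this

theorem map (h : X.IsCharIn S) {f : G →* G'} (hf : Function.Injective f) :
    (X.map f).IsCharIn (S.map f) := by
  refine ⟨map_mono h.1, ?_⟩
  rintro φ ⟨_, ⟨s, hs, rfl⟩⟩ ⟨x, hx, hxs⟩
  obtain rfl := hf hxs
  let e := S.equivMapOfInjective f hf
  have h1 := h.2 ((e.trans φ).trans e.symm) ⟨x, hs⟩ hx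
  refine ⟨_, h1, ?_⟩
  have h2 := S.coe_equivMapOfInjective_apply f hf (((e.trans φ).trans e.symm) ⟨x, hs⟩)
  rw [← h2]
  change ((e (e.symm (φ (e ⟨x, hs⟩))) : S.map f) : G') = _
  rw [MulEquiv.apply_symm_apply]
  congr 2

end Subgroup.IsCharIn

/-- The normalizers of all nontrivial characteristic subgroups of Sylow `p`-subgroups satisfy
Frobenius' condition. -/
def ThompsonCondition (p : ℕ) (G : Type*) [Group G] : Prop :=
  ∀ (S : Sylow p G) (X : Subgroup G), X.IsCharIn S → X ≠ ⊥ →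
    FrobeniusCondition p (normalizer (X : Set G))

namespace ThompsonCondition

variable {G : Type*} [Group G] {p : ℕ}

theorem of_map_subtype {H : Subgroup G} (h : ∀ (S : Sylow p H) (X : Subgroup G),
    X.IsCharIn ((S : Subgroup H).map H.subtype) → X ≠ ⊥ →
    FrobeniusCondition p (normalizer (X : Set G))) : ThompsonCondition p H := by
  intro S X hX hX1
  refine FrobeniusCondition.of_map H.subtype_injective ((h S (X.map H.subtype)
    (hX.map H.subtype_injective) ?_).mono (le_normalizer_map H.subtype))
  rwa [Ne, map_eq_bot_iff_of_injective _ H.subtype_injective]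

variable [Finite G] [Fact p.Prime]

theorem subgroup (h : ThompsonCondition p G) {H : Subgroup G} (hH : ¬ p ∣ H.index) :
    ThompsonCondition p H := by
  have hp := Fact.out (p := p.Prime)
  refine of_map_subtype fun S X hX hX1 => ?_
  have h1 : ¬ p ∣ ((S : Subgroup H).map H.subtype).index := by
    rw [index_map_subtype, hp.dvd_mul, not_or]
    exact ⟨S.not_dvd_index, hH⟩
  exact h ((S.2.map H.subtype).toSylow h1) X hX hX1

end ThompsonCondition

section MinimalCounterexample

variable {G : Type*} [Group G] [Finite G] {p : ℕ} [Fact p.Prime]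

theorem ThompsonCondition.exists_normal_ne_bot (h : ThompsonCondition p G)
    (hG : ¬ FrobeniusCondition p (⊤ : Subgroup G))
    (ih : ∀ H : Subgroup G, H ≠ ⊤ → ThompsonCondition p H → FrobeniusCondition p H) :
    ∃ D : Subgroup G, D.Normal ∧ IsPGroup p D ∧ D ≠ ⊥ := by
  let s : Set (Subgroup G × Subgroup G) := {x | IsPGroup p x.1 ∧ x.1 ≠ ⊥ ∧ IsPGroup p x.2 ∧
    x.2 ≤ normalizer (x.1 : Set G) ∧ ¬ FrobeniusCondition p (normalizer (x.1 : Set G))}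
  have hs : s.Nonempty := by
    rw [FrobeniusCondition] at hG
    push Not at hG
    obtain ⟨D, -, hD, x, -, hxD, hx, d, hd, hdx⟩ := hG
    refine ⟨(D, ⊥), hD, ?_, IsPGroup.of_bot, bot_le, ?_⟩
    · rintro rfl
      rw [mem_bot.1 hd] at hdx
      simp at hdx
    · exact fun hF => hdx (hF D le_normalizer hD x hxD hxD hx d hd)
  obtain ⟨⟨D, S⟩, ⟨hD, hD1, hS, hSD, hDF⟩, hmax⟩ :=
    s.exists_max_image (fun x => Nat.card x.2) (Set.toFinite s) hs
  dsimp only at hD hD1 hS hSD hDF hmax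
  have hN : ThompsonCondition p (normalizer (D : Set G)) := by
    set N := normalizer (D : Set G)
    refine ThompsonCondition.of_map_subtype fun T X hX hX1 => ?_
    set T' : Subgroup G := (T : Subgroup N).map N.subtype
    have hT' : IsPGroup p T' := T.2.map N.subtype
    have hcard : Nat.card S ≤ Nat.card T' := by
      obtain ⟨T₁, hT₁⟩ := (hS.comap_subtype (K := N)).exists_le_sylow
      have h1 : Nat.card S = Nat.card (S.subgroupOf N) :=
        (Nat.card_congr (subgroupOfEquivOfLe hSD).toEquiv).symm
      have h2 : Nat.card T' = Nat.card T := by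
        exact (Nat.card_congr ((T : Subgroup N).equivMapOfInjective N.subtype
          N.subtype_injective).toEquiv).symm
      have h3 : Nat.card T = Nat.card T₁ := by
        rw [T.card_eq_multiplicity, T₁.card_eq_multiplicity]
      rw [h1, h2, h3]
      exact Nat.card_le_card_of_injective (inclusion hT₁) (inclusion_injective hT₁)
    obtain ⟨P, hP⟩ := hT'.exists_le_sylow
    rcases hP.eq_or_lt with e | hlt
    · exact h P X (e ▸ hX) hX1
    · obtain ⟨g, hgP, hgT, hgN⟩ := P.2.exists_mem_normalizer_of_lt hlt
      by_contra hF
      set R : Subgroup G := P ⊓ normalizer (T' : Set G)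
      have hTR : T' < R := lt_of_le_of_ne (le_inf hlt.le le_normalizer)
        fun e => hgT (e ▸ ⟨hgP, hgN⟩)
      have h4 : Nat.card T' < Nat.card R := Set.ncard_lt_ncard (SetLike.coe_ssubset_coe.2 hTR)
      have h5 := hmax (X, R) ⟨hT'.to_le hX.1, hX1, P.2.to_le inf_le_left,
        inf_le_right.trans hX.normalizer_le, hF⟩
      dsimp only at h5
      omega
  refine ⟨D, ?_, hD, hD1⟩
  rw [← normalizer_eq_top_iff]
  by_contra hne
  exact hDF (ih _ hne hN)

theorem ThompsonCondition.quotient {U : Subgroup G} [U.Normal] (hU : IsPGroup p U)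
    (hmax : ∀ N : Subgroup G, N.Normal → IsPGroup p N → N ≤ U)
    (hF : ∀ H : Subgroup G, H ≠ ⊤ → ¬ p ∣ H.index → FrobeniusCondition p H) :
    ThompsonCondition p (G ⧸ U) := by
  intro S X hX hX1
  set f := QuotientGroup.mk' U
  have hf : Function.Surjective f := QuotientGroup.mk'_surjective U
  have h1 : (normalizer (X : Set (G ⧸ U))).comap f ≠ ⊤ := by
    intro e
    rw [comap_normalizer_eq_of_surjective X hf, normalizer_eq_top_iff] at e
    have h2 := hmax _ e ((S.2.to_le hX.1).comap_of_ker_isPGroup f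
      (by rwa [QuotientGroup.ker_mk']))
    apply hX1
    rw [← map_comap_eq_self_of_surjective hf X, eq_bot_iff]
    exact (map_mono h2).trans ((Subgroup.map_eq_bot_iff _).2 (QuotientGroup.ker_mk' U).ge).le
  have h3 := hF _ h1 fun hd => S.not_dvd_index (by
    rw [index_comap_of_surjective _ hf] at hd
    exact hd.trans (index_dvd_of_le (le_normalizer.trans hX.normalizer_le)))
  rw [← map_comap_eq_self_of_surjective hf (normalizer (X : Set (G ⧸ U)))]
  exact h3.map_of_finite f

end MinimalCounterexample

section Preliminaries

variable {G : Type*} [Group G] {p : ℕ}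

theorem Subgroup.relIndex_eq_relIndex_sup [Finite G] (H C : Subgroup G) [C.Normal] :
    H.relIndex C = H.relIndex (H ⊔ C) := by
  have h1 := relIndex_mul_relIndex (H ⊓ C) H (H ⊔ C) inf_le_left le_sup_left
  have h2 := relIndex_mul_relIndex (H ⊓ C) C (H ⊔ C) inf_le_right le_sup_right
  rw [relIndex_sup_right, ← h1, inf_relIndex_left, inf_relIndex_right, mul_comm] at h2
  exact Nat.eq_of_mul_eq_mul_left (Nat.pos_of_ne_zero index_ne_zero_of_finite) h2

/-- The Frattini argument for the intersection of a Sylow subgroup and a normal subgroup. -/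
theorem Sylow.normalizer_inf_sup_eq_top [Finite G] [Fact p.Prime] (P : Sylow p G) (C : Subgroup G)
    [C.Normal] : normalizer ((P ⊓ C : Subgroup G) : Set G) ⊔ C = ⊤ := by
  have h1 : ¬ p ∣ ((P : Subgroup G).subgroupOf C).index := by
    change ¬ p ∣ (P : Subgroup G).relIndex C
    rw [relIndex_eq_relIndex_sup]
    exact fun h => P.not_dvd_index (h.trans (relIndex_dvd_index_of_le le_sup_left))
  have h2 := Sylow.normalizer_sup_eq_top ((P.2.comap_subtype (K := C)).toSylow h1)
  rw [← subgroupOf_map_subtype (P : Subgroup G) C]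
  exact h2

theorem mem_of_forall_prime_pow_mem [Finite G] {C : Subgroup G}
    (h : ∀ q : ℕ, q.Prime → q ≠ p → ∀ u : G, (∃ k, u ^ q ^ k = 1) → u ∈ C) {x : G}
    (hx : ¬ p ∣ orderOf x) : x ∈ C := by
  induction hn : orderOf x using Nat.strong_induction_on generalizing x with
  | _ n ih =>
  subst hn
  by_cases h1 : orderOf x = 1
  · rw [orderOf_eq_one_iff.1 h1]; exact one_mem C
  have hq := Nat.minFac_prime h1
  have hqd := Nat.minFac_dvd (orderOf x)
  obtain ⟨u, hu, v, hv, huv, hu1, hv1⟩ := exists_mul_eq_of_prime hq x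
  have hvd := orderOf_dvd_of_mem_zpowers hv
  rw [huv]
  refine mul_mem (h _ hq (fun e => hx (e ▸ hqd)) u hu1) (ih _ ?_ (fun h => hx (h.trans hvd)) rfl)
  exact lt_of_le_of_ne (Nat.le_of_dvd (orderOf_pos x) hvd) fun e => hv1 (e ▸ hqd)

/-- The elements of exponent `p` in the centre of `S`. -/
def Subgroup.omegaCenter (p : ℕ) (S : Subgroup G) : Subgroup G where
  carrier := {z | z ∈ S ∧ z ∈ centralizer (S : Set G) ∧ z ^ p = 1}
  one_mem' := ⟨one_mem _, one_mem _, one_pow p⟩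
  mul_mem' := by
    rintro a b ⟨ha, ha1, ha2⟩ ⟨hb, hb1, hb2⟩
    refine ⟨mul_mem ha hb, mul_mem ha1 hb1, ?_⟩
    have h : Commute a b := mem_centralizer_iff.1 hb1 a ha
    rw [h.mul_pow, ha2, hb2, one_mul]
  inv_mem' := by
    rintro a ⟨ha, ha1, ha2⟩
    exact ⟨inv_mem ha, inv_mem ha1, by rw [inv_pow, ha2, inv_one]⟩

theorem Subgroup.omegaCenter_isCharIn (S : Subgroup G) : (S.omegaCenter p).IsCharIn S := by
  refine ⟨fun z hz => hz.1, fun φ x hx => ⟨(φ x).2, mem_centralizer_iff.2 fun y hy => ?_, ?_⟩⟩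
  · have h := mem_centralizer_iff.1 hx.2.1 (φ.symm ⟨y, hy⟩) (φ.symm ⟨y, hy⟩).2
    have h1 : φ.symm ⟨y, hy⟩ * x = x * φ.symm ⟨y, hy⟩ := Subtype.ext h
    have h2 := congrArg φ h1
    rw [map_mul, map_mul, MulEquiv.apply_symm_apply] at h2
    exact congrArg Subtype.val h2
  · have h : x ^ p = 1 := Subtype.ext hx.2.2
    have h2 := congrArg φ h
    rw [map_pow, map_one] at h2
    exact congrArg Subtype.val h2

theorem Subgroup.omegaCenter_ne_bot [Finite G] [Fact p.Prime] {S : Subgroup G}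
    (hS : IsPGroup p S) (h1 : S ≠ ⊥) : S.omegaCenter p ≠ ⊥ := by
  have : Nontrivial S := (nontrivial_iff_ne_bot S).2 h1
  have h2 : Nontrivial (center S) := hS.center_nontrivial
  have hc : IsPGroup p (center S) := hS.to_subgroup _
  obtain ⟨n, hn, hcard⟩ := (IsPGroup.nontrivial_iff_card hc).1 h2
  obtain ⟨z, hz⟩ := exists_prime_orderOf_dvd_card' (G := center S) p
    (hcard ▸ dvd_pow_self p hn.ne')
  intro e
  have h3 : ((z : S) : G) ∈ S.omegaCenter p := by
    refine ⟨(z : S).2, mem_centralizer_iff.2 fun y hy => ?_, ?_⟩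
    · exact congrArg Subtype.val (mem_center_iff.1 z.2 ⟨y, hy⟩)
    · have := pow_orderOf_eq_one z
      rw [hz] at this
      exact congrArg (fun t : center S => ((t : S) : G)) this
  rw [e, mem_bot] at h3
  have h4 : z = 1 := Subtype.ext (Subtype.ext h3)
  rw [h4, orderOf_one] at hz
  exact (Fact.out (p := p.Prime)).one_lt.ne hz

end Preliminaries

section MinimalCounterexampleStructure

theorem Subgroup.normalizer_inf_le_normalizer_sup {G : Type*} [Group G] (H K : Subgroup G) :
    normalizer (H : Set G) ⊓ normalizer (K : Set G) ≤ normalizer ((H ⊔ K : Subgroup G) : Set G) := by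
  rintro g ⟨hH, hK⟩
  replace hH := mem_normalizer_iff_map_conj_eq.1 hH
  replace hK := mem_normalizer_iff_map_conj_eq.1 hK
  rw [mem_normalizer_iff_map_conj_eq, Subgroup.map_sup, hH, hK]

theorem FrobeniusCondition.mem_centralizer {G : Type*} [Group G] {p : ℕ} {H U : Subgroup G} (h : FrobeniusCondition p H)
    [U.Normal] (hU : IsPGroup p U) (hUH : U ≤ H) {x : G} (hx : x ∈ H) (hxp : ¬ p ∣ orderOf x) :
    x ∈ centralizer (U : Set G) := by
  refine mem_centralizer_iff.2 fun u hu => (h U hUH hU x hx ?_ hxp u hu).symm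
  rw [normalizer_eq_top U]
  exact mem_top x

theorem FrobeniusCondition.top_of_quotient {G : Type*} [Group G] {p : ℕ} [Fact p.Prime]
    {U : Subgroup G} [U.Normal] (hU : IsPGroup p U)
    (h : FrobeniusCondition p (⊤ : Subgroup (G ⧸ U)))
    (hc : ∀ x : G, ¬ p ∣ orderOf x → x ∈ centralizer (U : Set G)) :
    FrobeniusCondition p (⊤ : Subgroup G) := by
  have hp := Fact.out (p := p.Prime)
  intro D _ hD x _ hxD hx d hd
  set f := QuotientGroup.mk' U
  have hfx : ¬ p ∣ orderOf (f x) := fun hd => hx (hd.trans (orderOf_map_dvd f x))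
  have h1 := h (D.map f) le_top (hD.map f) (f x) (mem_top _)
    (le_normalizer_map f (mem_map_of_mem f hxD)) hfx (f d) (mem_map_of_mem f hd)
  have hcU : x * d * x⁻¹ * d⁻¹ ∈ U := by
    rw [← QuotientGroup.ker_mk' U, MonoidHom.mem_ker]
    simp only [map_mul, map_inv]
    change f x * f d * (f x)⁻¹ * (f d)⁻¹ = 1
    rw [h1]; group
  set c := x * d * x⁻¹ * d⁻¹ with hcdef
  have hxc : c * x = x * c := mem_centralizer_iff.1 (hc x hx) c hcU
  have h2 : ∀ n : ℕ, x ^ n * d * (x ^ n)⁻¹ = c ^ n * d := by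
    intro n
    induction n with
    | zero => simp
    | succ n ih =>
      have h3 : x * c ^ n = c ^ n * x := (Commute.pow_right (show Commute x c from hxc.symm) n).eq
      calc x ^ (n + 1) * d * (x ^ (n + 1))⁻¹ = x * (x ^ n * d * (x ^ n)⁻¹) * x⁻¹ := by
            rw [pow_succ']; group
        _ = (x * c ^ n) * d * x⁻¹ := by rw [ih]; group
        _ = c ^ n * (x * d * x⁻¹ * d⁻¹) * d := by rw [h3]; group
        _ = c ^ (n + 1) * d := by rw [← hcdef, pow_succ]
  have h4 : c ^ orderOf x = 1 := by
    have := h2 (orderOf x)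
    rw [pow_orderOf_eq_one] at this
    simpa using this.symm
  have h5 : c = 1 := hU.eq_one_of_not_dvd hp hcU fun h => hx (h.trans (orderOf_dvd_of_pow_eq_one h4))
  rw [hcdef, mul_inv_eq_one, mul_inv_eq_iff_eq_mul] at h5
  exact h5

variable {G : Type*} [Group G] [Finite G] {p : ℕ} [Fact p.Prime]

theorem exists_normal_of_frobeniusCondition_quotient {U : Subgroup G} [U.Normal]
    (h : FrobeniusCondition p (⊤ : Subgroup (G ⧸ U)))
    {q : ℕ} (hq : q.Prime) {x : G} (hxp : ¬ p ∣ orderOf x) {k : ℕ} (hk : x ^ q ^ k = 1)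
    (hE : ∀ H : Subgroup G, U ≤ H → x ∈ H → ¬ p ∣ H.index → H = ⊤) :
    ∃ K : Subgroup G, K.Normal ∧ U ≤ K ∧ x ∈ K ∧ ∀ y ∈ K, ∃ n, y ^ q ^ n ∈ U := by
  obtain ⟨Kb, hKb, hKp, hKx⟩ := h.exists_normal_complement
  have : Fact q.Prime := ⟨hq⟩
  set f := QuotientGroup.mk' U with hfdef
  have hf : Function.Surjective f := QuotientGroup.mk'_surjective U
  set K := Kb.comap f with hK
  have hxK : x ∈ K := hKx _ fun hd => hxp (hd.trans (orderOf_map_dvd f x))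
  have hzp : IsPGroup q (zpowers (⟨x, hxK⟩ : K)) := by
    rintro ⟨_, n, rfl⟩
    refine ⟨k, Subtype.ext (Subtype.ext ?_)⟩
    change (x ^ n) ^ q ^ k = 1
    rw [← zpow_natCast, ← zpow_mul, mul_comm, zpow_mul, zpow_natCast, hk, one_zpow]
  obtain ⟨Q, hQ⟩ := hzp.exists_le_sylow
  set Q' : Subgroup G := (Q : Subgroup K).map K.subtype with hQ'
  have hxQ : x ∈ Q' := ⟨⟨x, hxK⟩, hQ (mem_zpowers _), rfl⟩
  have h1 : normalizer (Q' : Set G) ⊔ K = ⊤ := Sylow.normalizer_sup_eq_top Q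
  set N := normalizer (Q' : Set G) ⊔ U with hN
  have hNtop : N = ⊤ := by
    refine hE N le_sup_right (le_sup_left (a := normalizer (Q' : Set G)) (le_normalizer hxQ)) ?_
    have h2 : (N.map f).comap f = N := by
      rw [comap_map_eq, QuotientGroup.ker_mk', sup_eq_left]
      exact le_sup_right
    have h3 : N.map f ⊔ Kb = ⊤ := by
      rw [← map_comap_eq_self_of_surjective hf Kb, ← Subgroup.map_sup, ← map_top_of_surjective f hf]
      congr 1
      exact top_le_iff.1 (h1 ▸ sup_le_sup_right le_sup_left K)
    rw [← h2, index_comap_of_surjective _ hf, ← relIndex_top_right, ← h3,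
      ← relIndex_eq_relIndex_sup]
    exact fun hd => hKp (hd.trans (index_dvd_card _))
  refine ⟨U ⊔ Q', ?_, le_sup_left, le_sup_right (a := U) hxQ, fun y hy => ?_⟩
  · rw [← normalizer_eq_top_iff, eq_top_iff, ← hNtop, hN, sup_le_iff]
    refine ⟨?_, le_sup_left.trans le_normalizer⟩
    intro g hg
    refine normalizer_inf_le_normalizer_sup U Q' ⟨?_, hg⟩
    rw [normalizer_eq_top U]
    exact mem_top g
  · obtain ⟨u, hu, z, hz, rfl⟩ := mem_sup_of_normal_left.1 hy
    obtain ⟨⟨z, hzK⟩, hzQ, rfl⟩ := hz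
    obtain ⟨n, hn⟩ := Q.2 ⟨_, hzQ⟩
    refine ⟨n, ?_⟩
    have hn' : z ^ q ^ n = 1 := congrArg (fun t : Q => ((t : K) : G)) hn
    rw [← QuotientGroup.ker_mk' U, MonoidHom.mem_ker, map_pow, map_mul]
    have hu' : QuotientGroup.mk' U u = 1 := by
      rwa [← MonoidHom.mem_ker, QuotientGroup.ker_mk']
    rw [hu', one_mul, ← map_pow]
    change QuotientGroup.mk' U (z ^ q ^ n) = 1
    rw [hn', map_one]

theorem Subgroup.eq_bot_of_le_commutator {G : Type*} [Group G] {H : Subgroup G}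
    [Group.IsSolvable H] (h : H ≤ ⁅H, H⁆) :
    H = ⊥ := by
  by_contra hne
  have : Nontrivial H := (nontrivial_iff_ne_bot H).2 hne
  refine (Group.IsSolvable.commutator_lt_top_of_nontrivial H).ne ?_
  apply map_injective H.subtype_injective
  rw [map_subtype_commutator, ← MonoidHom.range_eq_map, range_subtype]
  exact le_antisymm (commutator_le_self H) h

theorem mem_of_pow_mem_of_pow_eq_one {G : Type*} [Group G] [Finite G] {p q : ℕ} (hq : q.Prime)
    (hp : p.Prime) (hqp : q ≠ p) {U : Subgroup G} {y : G} (hU : ∃ n, y ^ q ^ n ∈ U)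
    (hy : ∃ k, y ^ p ^ k = 1) : y ∈ U := by
  obtain ⟨n, hn⟩ := hU
  obtain ⟨k, hk⟩ := hy
  refine mem_of_pow_prime_pow_mem hq (fun hd => ?_) hn
  exact hqp ((Nat.prime_dvd_prime_iff_eq hq hp).1
    (hq.dvd_of_dvd_pow (hd.trans (orderOf_dvd_of_pow_eq_one hk))))

theorem mem_centralizer_omegaCenter_of_mem_commutator {U K : Subgroup G} [U.Normal] [K.Normal]
    (hU : IsPGroup p U) (hUK : U ≤ K) {q : ℕ} (hq : q.Prime) (hqp : q ≠ p)
    (hK : ∀ y ∈ K, ∃ n, y ^ q ^ n ∈ U) {x : G} (hxK : x ∈ K) (hxp : ¬ p ∣ orderOf x)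
    (hxU : x ∉ centralizer (U : Set G))
    (hF : ∀ H : Subgroup G, H ≠ ⊤ → ¬ p ∣ H.index → FrobeniusCondition p H)
    {y : G} (hy : y ∈ ⁅K, K⁆) : y ∈ centralizer (U.omegaCenter p : Set G) := by
  have hp := Fact.out (p := p.Prime)
  have : Fact q.Prime := ⟨hq⟩
  have hpU : ∀ y ∈ K, (∃ k, y ^ p ^ k = 1) → y ∈ U := fun y hy hyp =>
    mem_of_pow_mem_of_pow_eq_one hq hp hqp (hK y hy) hyp
  obtain ⟨P⟩ : Nonempty (Sylow p G) := inferInstance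
  have hne : (P : Subgroup G) ⊔ (U ⊔ ⁅K, K⁆) ≠ ⊤ := by
    intro e
    have h1 : K ≤ U ⊔ ⁅K, K⁆ := by
      intro k hk
      obtain ⟨a, ha, c, hc, rfl⟩ := mem_sup_of_normal_right.1 (e ▸ mem_top k)
      have hcK : c ∈ K := sup_le hUK (commutator_le_left K K) hc
      have haK : a ∈ K := (mul_mem_cancel_right hcK).1 hk
      refine mul_mem (le_sup_left (a := U) (hpU a haK ?_)) hc
      obtain ⟨n, hn⟩ := P.2 ⟨a, ha⟩
      exact ⟨n, congrArg Subtype.val hn⟩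
    set f := QuotientGroup.mk' U
    have h2 : IsPGroup q (K.map f) := by
      rintro ⟨_, y, hy, rfl⟩
      obtain ⟨n, hn⟩ := hK y hy
      refine ⟨n, Subtype.ext ?_⟩
      change (f y) ^ q ^ n = 1
      rw [← map_pow]
      exact (QuotientGroup.eq_one_iff _).2 hn
    have hUb : U.map f = ⊥ := (Subgroup.map_eq_bot_iff _).2 (QuotientGroup.ker_mk' U).ge
    have h3 : K.map f ≤ ⁅K.map f, K.map f⁆ := by
      have := map_mono (f := f) h1
      rwa [Subgroup.map_sup, map_commutator, hUb, bot_sup_eq] at this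
    have := h2.isNilpotent
    have h4 := Subgroup.eq_bot_of_le_commutator h3
    rw [Subgroup.map_eq_bot_iff, QuotientGroup.ker_mk'] at h4
    exact hxU (hU.eq_one_of_not_dvd hp (h4 hxK) hxp ▸ one_mem _)
  have hFC := hF _ hne fun hd => P.not_dvd_index (hd.trans (index_dvd_of_le le_sup_left))
  obtain ⟨u, hu, v, hv, rfl, hu1, hv1⟩ := exists_mul_eq_of_prime hp y
  have huC : u ∈ ⁅K, K⁆ := (zpowers_le.2 hy) hu
  have hvC : v ∈ ⁅K, K⁆ := (zpowers_le.2 hy) hv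
  refine mul_mem ?_ ?_
  · have huU := hpU u (commutator_le_left K K huC) hu1
    refine mem_centralizer_iff.2 fun z hz => ?_
    exact (mem_centralizer_iff.1 hz.2.1 u huU).symm
  · have h5 : v ∈ centralizer (U : Set G) := hFC.mem_centralizer hU
      (le_sup_left.trans le_sup_right) (le_sup_right (a := (P : Subgroup G)) (le_sup_right (a := U) hvC)) hv1
    exact centralizer_le (fun z hz => hz.1) h5

/-- If `C` is normal and `P` is a Sylow subgroup, then either `P ⊓ C` is normal or the elements of
order prime to `p` lie in every normal subgroup containing `C` and the centralizer of `U`. -/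
theorem Sylow.inf_normal_or_forall_mem {U : Subgroup G} [U.Normal] (hU : IsPGroup p U)
    (P : Sylow p G) (C : Subgroup G) [C.Normal] (hUP : U ≤ P)
    (hF : ∀ H : Subgroup G, H ≠ ⊤ → ¬ p ∣ H.index → FrobeniusCondition p H) :
    (P ⊓ C : Subgroup G).Normal ∨ ∀ M : Subgroup G, M.Normal → C ≤ M →
      centralizer (U : Set G) ≤ M → ∀ x : G, ¬ p ∣ orderOf x → x ∈ M := by
  have hp := Fact.out (p := p.Prime)
  by_cases hH : normalizer ((P ⊓ C : Subgroup G) : Set G) = ⊤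
  · exact Or.inl (normalizer_eq_top_iff.1 hH)
  refine Or.inr fun M hM hCM hUM x hx => ?_
  set H := normalizer ((P ⊓ C : Subgroup G) : Set G) with hHdef
  have hPH : (P : Subgroup G) ≤ H := by
    refine le_trans (le_inf le_normalizer ?_) inf_normalizer_le_normalizer_inf
    rw [normalizer_eq_top C]
    exact le_top
  have hFC := hF H hH fun hd => P.not_dvd_index (hd.trans (index_dvd_of_le hPH))
  have hx1 : x ∈ H ⊔ C := by rw [Sylow.normalizer_inf_sup_eq_top]; exact mem_top x
  obtain ⟨h, hh, c, hc, rfl⟩ := mem_sup_of_normal_right.1 hx1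
  obtain ⟨k, hk⟩ := exists_not_dvd_orderOf_pow hp h
  have h2 : h ^ p ^ k ∈ M := hUM (hFC.mem_centralizer hU (hUP.trans hPH) (pow_mem hh _) hk)
  refine mem_of_pow_prime_pow_mem hp hx (k := k) ?_
  rw [← QuotientGroup.eq_one_iff] at h2 ⊢
  rw [QuotientGroup.mk_pow, QuotientGroup.mk_mul, (QuotientGroup.eq_one_iff c).2 (hCM hc), mul_one,
    ← QuotientGroup.mk_pow, h2]

end MinimalCounterexampleStructure

section ElementaryAbelian

variable {G : Type*} [Group G] {p : ℕ}

/-- `A` is abelian of exponent dividing `p`. -/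
def Subgroup.IsElementaryAbelian (p : ℕ) (A : Subgroup G) : Prop :=
  (∀ a ∈ A, ∀ b ∈ A, a * b = b * a) ∧ ∀ a ∈ A, a ^ p = 1

/-- `A` is an elementary abelian subgroup of `S` of maximal order. -/
def Subgroup.IsMaxElementaryAbelian (p : ℕ) (S A : Subgroup G) : Prop :=
  A ≤ S ∧ A.IsElementaryAbelian p ∧
    ∀ B ≤ S, B.IsElementaryAbelian p → Nat.card B ≤ Nat.card A

/-- The elementary abelian version of the Thompson subgroup. -/
def Subgroup.thompson (p : ℕ) (S : Subgroup G) : Subgroup G :=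
  sSup {A | S.IsMaxElementaryAbelian p A}

theorem Subgroup.omegaCenter_isElementaryAbelian (S : Subgroup G) :
    (S.omegaCenter p).IsElementaryAbelian p :=
  ⟨fun _ ha _ hb => mem_centralizer_iff.1 hb.2.1 _ ha.1, fun _ ha => ha.2.2⟩

theorem Subgroup.IsElementaryAbelian.map {G' : Type*} [Group G'] {A : Subgroup G}
    (h : A.IsElementaryAbelian p) (f : G →* G') : (A.map f).IsElementaryAbelian p := by
  refine ⟨?_, ?_⟩
  · rintro _ ⟨a, ha, rfl⟩ _ ⟨b, hb, rfl⟩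
    rw [← map_mul, ← map_mul, h.1 a ha b hb]
  · rintro _ ⟨a, ha, rfl⟩
    rw [← map_pow, h.2 a ha, map_one]

theorem Subgroup.thompson_isCharIn (S : Subgroup G) : (S.thompson p).IsCharIn S := by
  refine ⟨sSup_le fun A hA => hA.1, fun φ x hx => ?_⟩
  have h1 : S.thompson p ≤ (((S.thompson p).comap S.subtype).comap φ.toMonoidHom).map S.subtype := by
    refine sSup_le fun A hA a ha => ⟨⟨a, hA.1 ha⟩, ?_, rfl⟩
    let f : S →* G := S.subtype.comp φ.toMonoidHom
    have hf : Function.Injective f := S.subtype_injective.comp φ.injective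
    have hinv : (A.subgroupOf S).map S.subtype = A := by
      rw [subgroupOf_map_subtype, inf_eq_left.2 hA.1]
    have hel : (A.subgroupOf S).IsElementaryAbelian p :=
      ⟨fun a ha b hb => Subtype.ext (hA.2.1.1 a ha b hb),
        fun a ha => Subtype.ext (hA.2.1.2 a ha)⟩
    have hcard : Nat.card ((A.subgroupOf S).map f) = Nat.card A := by
      rw [card_map_of_injective hf, Nat.card_congr (subgroupOfEquivOfLe hA.1).toEquiv]
    have hmax : S.IsMaxElementaryAbelian p ((A.subgroupOf S).map f) := by
      refine ⟨?_, hel.map f, hcard ▸ hA.2.2⟩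
      rintro _ ⟨y, -, rfl⟩
      exact (φ y).2
    have hle : (A.subgroupOf S).map f ≤ S.thompson p := le_sSup hmax
    exact hle (mem_map_of_mem f (show (⟨a, hA.1 ha⟩ : S) ∈ A.subgroupOf S from ha))
  obtain ⟨y, hy, hyx⟩ := h1 hx
  rw [← Subtype.ext hyx]
  exact hy

theorem Subgroup.exists_isMaxElementaryAbelian [Finite G] (S : Subgroup G) :
    ∃ A, S.IsMaxElementaryAbelian p A := by
  obtain ⟨A, hA, hmax⟩ := {A : Subgroup G | A ≤ S ∧ A.IsElementaryAbelian p}.exists_max_image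
    (fun A => Nat.card A) (Set.toFinite _) ⟨S.omegaCenter p, fun z hz => hz.1,
      S.omegaCenter_isElementaryAbelian⟩
  exact ⟨A, hA.1, hA.2, fun B hB hB1 => hmax B ⟨hB, hB1⟩⟩

theorem Subgroup.thompson_eq_of_le [Finite G] {S U : Subgroup G} (hUS : U ≤ S)
    (h : S.thompson p ≤ U) : S.thompson p = U.thompson p := by
  obtain ⟨A₀, hA₀⟩ := S.exists_isMaxElementaryAbelian (p := p)
  have h0 : ∀ A, S.IsMaxElementaryAbelian p A → A ≤ U := fun A hA =>
    le_trans (show A ≤ S.thompson p from le_sSup hA) h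
  unfold Subgroup.thompson
  congr 1
  ext A
  exact ⟨fun hA => ⟨h0 A hA, hA.2.1, fun B hB => hA.2.2 B (hB.trans hUS)⟩,
    fun hA => ⟨hA.1.trans hUS, hA.2.1, fun B hB hB1 =>
      (hA₀.2.2 B hB hB1).trans (hA.2.2 A₀ (h0 _ hA₀) hA₀.2.1)⟩⟩

theorem Subgroup.thompson_ne_bot [Finite G] [Fact p.Prime] {S : Subgroup G} (hS : IsPGroup p S)
    (h1 : S ≠ ⊥) : S.thompson p ≠ ⊥ := by
  obtain ⟨A, hA⟩ := S.exists_isMaxElementaryAbelian (p := p)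
  intro e
  have h2 : A = ⊥ := le_bot_iff.1 (e ▸ (le_sSup hA : A ≤ S.thompson p))
  have h3 := hA.2.2 (S.omegaCenter p) (fun z hz => hz.1) (S.omegaCenter_isElementaryAbelian (p := p))
  rw [h2, card_bot] at h3
  exact omegaCenter_ne_bot hS h1 ((card_le_one_iff_eq_bot _).1 h3)

theorem Subgroup.IsElementaryAbelian.sup {A B : Subgroup G} [B.Normal]
    (hA : A.IsElementaryAbelian p) (hB : B.IsElementaryAbelian p)
    (h : A ≤ centralizer (B : Set G)) : (A ⊔ B).IsElementaryAbelian p := by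
  have hc : ∀ a ∈ A, ∀ b ∈ B, Commute a b := fun a ha b hb =>
    (mem_centralizer_iff.1 (h ha) b hb).symm
  refine ⟨fun x hx y hy => ?_, fun x hx => ?_⟩
  · obtain ⟨a, ha, b, hb, rfl⟩ := mem_sup_of_normal_right.1 hx
    obtain ⟨c, hc', d, hd, rfl⟩ := mem_sup_of_normal_right.1 hy
    have h1 : Commute a c := hA.1 a ha c hc'
    have h2 : Commute b d := hB.1 b hb d hd
    exact ((h1.mul_right (hc a ha d hd)).mul_left ((hc c hc' b hb).symm.mul_right h2)).eq
  · obtain ⟨a, ha, b, hb, rfl⟩ := mem_sup_of_normal_right.1 hx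
    rw [(hc a ha b hb).mul_pow, hA.2 a ha, hB.2 b hb, one_mul]

end ElementaryAbelian

/-- `card_sq_mul_card_fixedPoints_le` for groups of automorphisms. -/
theorem MulAut.card_sq_mul_card_fixed_le {V : Type*} [Group V] [Finite V] {p : ℕ} [Fact p.Prime]
    (hp2 : p ≠ 2) (hcomm : ∀ a b : V, a * b = b * a) (hV : ∀ v : V, v ^ p = 1)
    {Q : Subgroup (MulAut V)} (hQ : ∀ x ∈ Q, ∀ y ∈ Q, x * y = y * x) (hQp : ¬ p ∣ Nat.card Q)
    {A : Subgroup (MulAut V)} (hA : A.IsElementaryAbelian p)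
    (hAQ : A ≤ normalizer (Q : Set (MulAut V)))
    (hf : ∀ a ∈ A, (∀ x ∈ Q, a * x = x * a) → a = 1) :
    Nat.card A ^ 2 * Nat.card {v : V | ∀ a ∈ A, a v = v} ≤ Nat.card V := by
  let _ : CommGroup V := { (inferInstance : Group V) with mul_comm := hcomm }
  let _ : DistribMulAction (MulAut V) (Additive V) :=
    { smul := fun f v => Additive.ofMul (f v.toMul)
      one_smul := fun v => rfl
      mul_smul := fun f g v => rfl
      smul_zero := fun f => map_one f
      smul_add := fun f v w => map_mul f v.toMul w.toMul }
  have _ : FaithfulSMul (MulAut V) (Additive V) :=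
    ⟨fun {f g} h => MulEquiv.ext fun v => h (Additive.ofMul v)⟩
  have key := card_sq_mul_card_fixedPoints_le (Γ := MulAut V) (V := Additive V) hp2
    (fun v => hV v.toMul) hQ hQp A hA.1 hA.2 hAQ hf
  refine le_of_eq_of_le ?_ key
  congr 1
  refine Nat.card_congr (Equiv.subtypeEquiv Additive.ofMul fun v => ?_)
  exact ⟨fun h a => h a.1 a.2, fun h a ha => h ⟨a, ha⟩⟩

theorem Subgroup.IsCharIn.normal {G : Type*} [Group G] {X S : Subgroup G} (h : X.IsCharIn S)
    [S.Normal] : X.Normal := by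
  rw [← normalizer_eq_top_iff, eq_top_iff, ← normalizer_eq_top S]
  exact h.normalizer_le

theorem Subgroup.card_inf_mul_relIndex {G : Type*} [Group G] (H K : Subgroup G) :
    Nat.card (K ⊓ H : Subgroup G) * H.relIndex K = Nat.card K := by
  rw [← inf_relIndex_left, ← relIndex_bot_left, ← relIndex_bot_left]
  exact relIndex_mul_relIndex _ _ _ bot_le inf_le_left

theorem Subgroup.le_of_commutator_le_centralizer {G : Type*} [Group G] [Finite G] {p : ℕ}
    [Fact p.Prime] (hp2 : p ≠ 2) {U K V P : Subgroup G} [V.Normal] [K.Normal]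
    (hV : V.IsElementaryAbelian p) (hVP : V ≤ P)
    (hKp : ¬ p ∣ Nat.card (K.map (MulAut.conjNormal (H := V))))
    (hKV : ⁅K, K⁆ ≤ centralizer (V : Set G))
    (h : ∀ g ∈ P, (∀ k ∈ K, ⁅g, k⁆ ∈ centralizer (V : Set G)) → g ∈ U)
    (hUV : U ≤ centralizer (V : Set G)) {A : Subgroup G} (hA : P.IsMaxElementaryAbelian p A) :
    A ≤ U := by
  set φ : G →* MulAut V := MulAut.conjNormal with hφ
  have hker : φ.ker = centralizer (V : Set G) := by
    ext g
    rw [MonoidHom.mem_ker, mem_centralizer_iff, MulEquiv.ext_iff]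
    refine ⟨fun h v hv => ?_, fun h v => Subtype.ext ?_⟩
    · have := congrArg Subtype.val (h ⟨v, hv⟩)
      rw [MulAut.conjNormal_apply, MulAut.one_apply, mul_inv_eq_iff_eq_mul] at this
      exact this.symm
    · rw [MulAut.conjNormal_apply, MulAut.one_apply, mul_inv_eq_iff_eq_mul]
      exact (h v v.2).symm
  have hcomm : ∀ {a b : G}, ⁅a, b⁆ ∈ centralizer (V : Set G) ↔ φ a * φ b = φ b * φ a := by
    intro a b
    rw [← hker, MonoidHom.mem_ker, map_commutatorElement, commutatorElement_eq_one_iff_mul_comm]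
  have key := MulAut.card_sq_mul_card_fixed_le hp2
    (fun a b : V => Subtype.ext (hV.1 a a.2 b b.2)) (fun v => Subtype.ext (hV.2 v v.2))
    (Q := K.map φ) ?_ hKp (hA.2.1.map φ) ?_ ?_
  rotate_left
  · rintro _ ⟨a, ha, rfl⟩ _ ⟨b, hb, rfl⟩
    exact hcomm.1 (hKV (commutator_mem_commutator ha hb))
  · refine le_trans ?_ (le_normalizer_map φ)
    rw [normalizer_eq_top K]
    exact map_mono le_top
  · rintro _ ⟨a, ha, rfl⟩ h1
    rw [← MonoidHom.mem_ker, hker]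
    exact hUV (h a (hA.1 ha) fun k hk => hcomm.2 (h1 _ (mem_map_of_mem φ hk)))
  set F : Set V := {v : V | ∀ a ∈ A.map φ, a v = v} with hF
  have hF0 : 0 < Nat.card F := by
    have : Nonempty F := ⟨⟨1, fun a _ => map_one a⟩⟩
    exact Nat.card_pos
  have hVC : V ≤ centralizer (V : Set G) := fun v hv =>
    mem_centralizer_iff.2 fun w hw => hV.1 w hw v hv
  set A' := A ⊓ centralizer (V : Set G) with hA'
  have h1 : Nat.card A' * Nat.card (A.map φ) = Nat.card A := by
    rw [← relIndex_ker, hker]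
    exact card_inf_mul_relIndex _ _
  have h2 : Nat.card (A' ⊔ V : Subgroup G) ≤ Nat.card A := by
    refine hA.2.2 _ (sup_le (inf_le_left.trans hA.1) hVP) (IsElementaryAbelian.sup ?_ hV inf_le_right)
    exact ⟨fun a ha b hb => hA.2.1.1 a ha.1 b hb.1, fun a ha => hA.2.1.2 a ha.1⟩
  have h3 := card_inf_mul_relIndex V (A' ⊔ V)
  rw [inf_eq_right.2 le_sup_right, relIndex_sup_right] at h3
  have h4 := card_inf_mul_relIndex V A'
  have h5 : Nat.card (A' ⊓ V : Subgroup G) ≤ Nat.card F := by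
    refine Nat.card_le_card_of_injective
      (fun v : (A' ⊓ V : Subgroup G) => (⟨⟨v, v.2.2⟩, ?_⟩ : F)) ?_
    · rintro _ ⟨a, ha, rfl⟩
      refine Subtype.ext ?_
      rw [MulAut.conjNormal_apply, mul_inv_eq_iff_eq_mul]
      exact hA.2.1.1 a ha _ v.2.1.1
    · intro v w hvw
      exact Subtype.ext (congrArg (fun t : F => ((t : V) : G)) hvw)
  have hA'0 : 0 < Nat.card A' := Nat.card_pos
  have hφ0 : 0 < Nat.card (A.map φ) := Nat.card_pos
  have h6 : Nat.card V ≤ Nat.card (A.map φ) * Nat.card F := by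
    refine Nat.le_of_mul_le_mul_left ?_ hA'0
    calc Nat.card A' * Nat.card V
        = Nat.card (A' ⊓ V : Subgroup G) * Nat.card (A' ⊔ V : Subgroup G) := by
          rw [← h4, ← h3]; ring
      _ ≤ Nat.card F * Nat.card A := Nat.mul_le_mul h5 h2
      _ = _ := by rw [← h1]; ring
  have h7 : Nat.card (A.map φ) ≤ 1 := by
    refine Nat.le_of_mul_le_mul_left (?_ : Nat.card (A.map φ) * Nat.card F * _ ≤ _ * 1)
      (Nat.mul_pos hφ0 hF0)
    calc _ = Nat.card (A.map φ) ^ 2 * Nat.card F := by ring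
      _ ≤ _ := by rw [mul_one]; exact key.trans h6
  have h8 : A ≤ centralizer (V : Set G) := by
    rw [← hker, ← Subgroup.map_eq_bot_iff]
    exact (card_le_one_iff_eq_bot _).1 h7
  exact fun a ha => h a (hA.1 ha) fun k _ =>
    hcomm.2 (by rw [show φ a = 1 from hker.ge (h8 ha), one_mul, mul_one])

section Contradiction

variable {G : Type*} [Group G] [Finite G] {p : ℕ} [Fact p.Prime]

theorem ThompsonCondition.top_of_sylow_centralizes (h : ThompsonCondition p G)
    (P : Sylow p G) {K : Subgroup G} (hP : (P : Subgroup G) ≠ ⊥) (hPK : (P : Subgroup G) ⊔ K = ⊤)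
    (hK : K ≤ centralizer ((P : Subgroup G).omegaCenter p : Set G)) :
    FrobeniusCondition p (⊤ : Subgroup G) := by
  have h1 := h P _ (omegaCenter_isCharIn _) (omegaCenter_ne_bot P.2 hP)
  have h2 : normalizer ((P : Subgroup G).omegaCenter p : Set G) = ⊤ := by
    rw [eq_top_iff, ← hPK]
    exact sup_le (le_normalizer.trans (omegaCenter_isCharIn _).normalizer_le)
      (hK.trans (centralizer_le_normalizer _))
  rwa [h2] at h1

theorem ThompsonCondition.mem_of_commutator_mem_centralizer (h : ThompsonCondition p G)
    (hG : ¬ FrobeniusCondition p (⊤ : Subgroup G)) {U V K : Subgroup G} [U.Normal] [V.Normal]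
    [K.Normal] (hU : IsPGroup p U) (hmax : ∀ N : Subgroup G, N.Normal → IsPGroup p N → N ≤ U)
    (hF : ∀ H : Subgroup G, H ≠ ⊤ → ¬ p ∣ H.index → FrobeniusCondition p H)
    (P : Sylow p G) (hUP : U ≤ P) (hP : (P : Subgroup G) ≠ ⊥) (hPK : (P : Subgroup G) ⊔ K = ⊤)
    (hVU : V ≤ U) (hPV : (P : Subgroup G).omegaCenter p ≤ V)
    (hKp : ∀ y ∈ K, (∃ k, y ^ p ^ k = 1) → y ∈ centralizer (V : Set G))
    {g : G} (hg : g ∈ P) (hgK : ∀ k ∈ K, ⁅g, k⁆ ∈ centralizer (V : Set G)) : g ∈ U := by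
  have hp := Fact.out (p := p.Prime)
  set C := centralizer (V : Set G) with hC
  set M := (centralizer (K.map (QuotientGroup.mk' C) : Set (G ⧸ C))).comap (QuotientGroup.mk' C)
    with hM
  have hmemM : ∀ x, x ∈ M ↔ ∀ k ∈ K, ⁅x, k⁆ ∈ C := by
    intro x
    rw [hM, mem_comap, mem_centralizer_iff]
    refine ⟨fun h k hk => ?_, ?_⟩
    · rw [← QuotientGroup.eq_one_iff]
      change QuotientGroup.mk' C ⁅x, k⁆ = 1
      rw [map_commutatorElement, commutatorElement_eq_one_iff_mul_comm]
      exact (h _ (mem_map_of_mem _ hk)).symm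
    · rintro h _ ⟨k, hk, rfl⟩
      have h1 := h k hk
      rw [← QuotientGroup.eq_one_iff] at h1
      change QuotientGroup.mk' C ⁅x, k⁆ = 1 at h1
      rw [map_commutatorElement, commutatorElement_eq_one_iff_mul_comm] at h1
      exact h1.symm
  have hMn : M.Normal := by
    have : (K.map (QuotientGroup.mk' C)).Normal :=
      Normal.map ‹K.Normal› _ (QuotientGroup.mk'_surjective C)
    infer_instance
  set M' := C ⊔ (P ⊓ M) with hM'
  have hM'n : M'.Normal := by
    rw [← normalizer_eq_top_iff, eq_top_iff, ← hPK, sup_le_iff]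
    constructor
    · refine le_trans (le_inf ?_ (le_trans (le_inf le_normalizer ?_)
        inf_normalizer_le_normalizer_inf)) (normalizer_inf_le_normalizer_sup _ _)
      · rw [normalizer_eq_top C]; exact le_top
      · rw [normalizer_eq_top M]; exact le_top
    · have hk : ∀ k ∈ K, ∀ y ∈ M', k * y * k⁻¹ ∈ M' := by
        intro k hk y hy
        obtain ⟨c, hc, m, hm, rfl⟩ := mem_sup_of_normal_left.1 hy
        have h1 : k * c * k⁻¹ ∈ C := Normal.conj_mem inferInstance c hc k
        have h2 : ⁅m, k⁆ ∈ C := (hmemM m).1 hm.2 k hk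
        have h3 : k * (c * m) * k⁻¹ = (k * c * k⁻¹) * (⁅m, k⁆)⁻¹ * m := by
          rw [commutatorElement_def]; group
        rw [h3]
        exact mul_mem (le_sup_left (a := C) (mul_mem h1 (inv_mem h2))) (le_sup_right (a := C) hm)
      intro k hkK
      refine mem_normalizer_iff.2 fun y => ⟨hk k hkK y, fun hy => ?_⟩
      simpa [mul_assoc] using hk _ (inv_mem hkK) _ hy
  have hCM : C ≤ M' := le_sup_left
  rcases P.inf_normal_or_forall_mem hU M' hUP hF with hn | hall
  · exact hmax _ hn (P.2.to_le inf_le_left) ⟨hg, le_sup_right (a := C) ⟨hg, (hmemM g).2 hgK⟩⟩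
  · have hpC : ∀ x : G, ¬ p ∣ orderOf x → x ∈ C := by
      intro x hx
      obtain ⟨c, hc, m, hm, rfl⟩ := mem_sup_of_normal_left.1
        (hall M' hM'n le_rfl ((centralizer_le hVU).trans hCM) x hx)
      obtain ⟨n, hn⟩ := P.2 ⟨m, hm.1⟩
      have hn' : m ^ p ^ n = 1 := congrArg Subtype.val hn
      refine mem_of_pow_prime_pow_mem hp hx (k := n) ?_
      rw [← QuotientGroup.eq_one_iff, QuotientGroup.mk_pow, QuotientGroup.mk_mul,
        (QuotientGroup.eq_one_iff c).2 hc, one_mul, ← QuotientGroup.mk_pow, hn',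
        QuotientGroup.mk_one]
    refine absurd (h.top_of_sylow_centralizes P hP hPK fun y hy => ?_) hG
    obtain ⟨u, hu, v, hv, rfl, hu1, hv1⟩ := exists_mul_eq_of_prime hp y
    exact centralizer_le hPV (mul_mem (hKp u ((zpowers_le.2 hy) hu) hu1) (hpC v hv1))

/-- One step of the induction proving Thompson's normal `p`-complement theorem. -/
theorem ThompsonCondition.top_of_forall (hp2 : p ≠ 2) (h : ThompsonCondition p G)
    (hsub : ∀ H : Subgroup G, H ≠ ⊤ → ThompsonCondition p H → FrobeniusCondition p H)
    (hquot : ∀ (U : Subgroup G) [U.Normal], U ≠ ⊥ → ThompsonCondition p (G ⧸ U) →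
      FrobeniusCondition p (⊤ : Subgroup (G ⧸ U))) :
    FrobeniusCondition p (⊤ : Subgroup G) := by
  have hp := Fact.out (p := p.Prime)
  by_contra hG
  have hF : ∀ H : Subgroup G, H ≠ ⊤ → ¬ p ∣ H.index → FrobeniusCondition p H :=
    fun H hH hHp => hsub H hH (h.subgroup hHp)
  obtain ⟨U, ⟨hUn, hU⟩, hUmax⟩ :=
    {N : Subgroup G | N.Normal ∧ IsPGroup p N}.exists_max_image (fun N => Nat.card N)
      (Set.toFinite _) ⟨⊥, inferInstance, IsPGroup.of_bot⟩
  have hmax : ∀ N : Subgroup G, N.Normal → IsPGroup p N → N ≤ U := by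
    intro N hN hNp
    have h1 := hUmax (U ⊔ N) ⟨sup_normal U N, hU.to_sup_of_normal_right hNp⟩
    have h2 := eq_of_le_of_card_ge (le_sup_left : U ≤ U ⊔ N) h1
    exact h2 ▸ le_sup_right
  have hU1 : U ≠ ⊥ := by
    obtain ⟨D, hD, hDp, hD1⟩ := h.exists_normal_ne_bot hG hsub
    rintro rfl
    exact hD1 (le_bot_iff.1 (hmax D hD hDp))
  have hquotU := hquot U hU1 (ThompsonCondition.quotient hU hmax hF)
  obtain ⟨x, hxp, q, hq, hqp, k, hk, hxU⟩ : ∃ x : G, ¬ p ∣ orderOf x ∧ ∃ q : ℕ, q.Prime ∧ q ≠ p ∧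
      ∃ k, x ^ q ^ k = 1 ∧ x ∉ centralizer (U : Set G) := by
    by_contra! hcon
    refine hG (FrobeniusCondition.top_of_quotient hU hquotU fun x hx =>
      mem_of_forall_prime_pow_mem (fun q hq hqp u ⟨k, hu⟩ => hcon u (fun hd => ?_) q hq hqp k hu) hx)
    exact hqp ((Nat.prime_dvd_prime_iff_eq hp hq).1
      (hp.dvd_of_dvd_pow (hd.trans (orderOf_dvd_of_pow_eq_one hu)))).symm
  have hE : ∀ H : Subgroup G, U ≤ H → x ∈ H → ¬ p ∣ H.index → H = ⊤ := by
    intro H hUH hxH hHp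
    by_contra hne
    exact hxU ((hF H hne hHp).mem_centralizer hU hUH hxH hxp)
  obtain ⟨K, hKn, hUK, hxK, hKq⟩ :=
    exists_normal_of_frobeniusCondition_quotient hquotU hq hxp hk hE
  obtain ⟨P, hUP⟩ := hU.exists_le_sylow
  have hP1 : (P : Subgroup G) ≠ ⊥ := fun e => hU1 (le_bot_iff.1 (e ▸ hUP))
  have hPK : (P : Subgroup G) ⊔ K = ⊤ := hE _ (hUK.trans le_sup_right)
    (le_sup_right (a := (P : Subgroup G)) hxK)
    fun hd => P.not_dvd_index (hd.trans (index_dvd_of_le le_sup_left))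
  have hVn : (U.omegaCenter p).Normal := (omegaCenter_isCharIn U).normal
  have hVU : U.omegaCenter p ≤ U := fun z hz => hz.1
  have hUV : U ≤ centralizer (U.omegaCenter p : Set G) := fun u hu =>
    mem_centralizer_iff.2 fun z hz => (mem_centralizer_iff.1 hz.2.1 u hu).symm
  have hPV : (P : Subgroup G).omegaCenter p ≤ U.omegaCenter p := by
    have hPC : (P ⊓ centralizer (U : Set G) : Subgroup G) ≤ U := by
      rcases P.inf_normal_or_forall_mem hU (centralizer (U : Set G)) hUP hF with hn | hall
      · exact hmax _ hn (P.2.to_le inf_le_left)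
      · exact absurd (hall _ inferInstance le_rfl le_rfl x hxp) hxU
    intro z hz
    have hzU : z ∈ centralizer (U : Set G) := centralizer_le hUP hz.2.1
    exact ⟨hPC ⟨hz.1, hzU⟩, hzU, hz.2.2⟩
  have hKU : ∀ y ∈ K, (∃ k, y ^ p ^ k = 1) → y ∈ U := fun y hy hyp =>
    mem_of_pow_mem_of_pow_eq_one hq hp hqp (hKq y hy) hyp
  have hPU : (P : Subgroup G).thompson p ≤ U := by
    refine sSup_le fun A hA => le_of_commutator_le_centralizer hp2
      (omegaCenter_isElementaryAbelian U) (hVU.trans hUP) (K := K) ?_ (fun y hy =>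
        mem_centralizer_omegaCenter_of_mem_commutator hU hUK hq hqp hKq hxK hxp hxU hF hy)
      (fun g hg hgK => h.mem_of_commutator_mem_centralizer hG hU hmax hF P hUP hP1 hPK hVU hPV
        (fun y hy hyp => hUV (hKU y hy hyp)) hg hgK) hUV hA
    have : Fact q.Prime := ⟨hq⟩
    have hKi : IsPGroup q (K.map (MulAut.conjNormal (H := U.omegaCenter p))) := by
      rintro ⟨_, y, hy, rfl⟩
      obtain ⟨n, hn⟩ := hKq y hy
      refine ⟨n, Subtype.ext (MulEquiv.ext fun v => Subtype.ext ?_)⟩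
      change (((MulAut.conjNormal y) ^ q ^ n : MulAut (U.omegaCenter p)) v : G) = v
      rw [← map_pow, MulAut.conjNormal_apply, mul_inv_eq_iff_eq_mul]
      exact (mem_centralizer_iff.1 (hUV hn) v v.2).symm
    obtain ⟨n, hn⟩ := hKi.exists_card_eq
    rw [hn]
    exact fun hd => hqp ((Nat.prime_dvd_prime_iff_eq hp hq).1 (hp.dvd_of_dvd_pow hd)).symm
  have hJ := h P _ (thompson_isCharIn _) (thompson_ne_bot P.2 hP1)
  have hJn : ((P : Subgroup G).thompson p).Normal := by
    rw [thompson_eq_of_le hUP hPU]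
    exact (thompson_isCharIn U).normal
  rw [normalizer_eq_top] at hJ
  exact hG hJ

end Contradiction

/-- A form of Thompson's normal `p`-complement theorem for odd primes. -/
theorem ThompsonCondition.frobeniusCondition_top {G : Type*} [Group G] [Finite G] {p : ℕ}
    [Fact p.Prime] (hp2 : p ≠ 2) (h : ThompsonCondition p G) :
    FrobeniusCondition p (⊤ : Subgroup G) := by
  induction hn : Nat.card G using Nat.strong_induction_on generalizing G with
  | _ n ih =>
  subst hn
  refine h.top_of_forall hp2 (fun H hH hHt => ?_) fun U _ hU hUt => ?_
  · exact FrobeniusCondition.top_iff.1 (ih _ (lt_of_le_of_ne (card_le_card_group H)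
      fun e => hH (eq_top_of_card_eq H e)) hHt rfl)
  · refine ih _ ?_ hUt rfl
    rw [card_eq_card_quotient_mul_card_subgroup U]
    have h1 : 1 < Nat.card U := U.one_lt_card_iff_ne_bot.2 hU
    exact lt_mul_of_one_lt_right Nat.card_pos h1

theorem FrobeniusCondition.top_of_isNilpotent {G : Type*} [Group G] [Finite G] {p : ℕ}
    [Fact p.Prime] [Group.IsNilpotent G] : FrobeniusCondition p (⊤ : Subgroup G) := by
  intro D _ hD x _ _ hx d hd
  obtain ⟨P, hP⟩ := hD.exists_le_sylow
  have hsylow : ∀ (q : ℕ) [Fact q.Prime] (Q : Sylow q G), (Q : Subgroup G).Normal := fun q _ Q =>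
    Q.normal_of_normalizerCondition Group.normalizerCondition_of_isNilpotent
  have h : x ∈ centralizer (P : Set G) := by
    refine mem_of_forall_prime_pow_mem (fun q hq hqp u ⟨k, hk⟩ => ?_) hx
    have : Fact q.Prime := ⟨hq⟩
    have hu : IsPGroup q (zpowers u) := by
      rintro ⟨_, n, rfl⟩
      refine ⟨k, Subtype.ext ?_⟩
      change (u ^ n) ^ q ^ k = 1
      rw [← zpow_natCast, ← zpow_mul, mul_comm, zpow_mul, zpow_natCast, hk, one_zpow]
    obtain ⟨Q, hQ⟩ := hu.exists_le_sylow
    exact mem_centralizer_iff.2 fun y hy => (commute_of_normal_of_disjoint _ _ (hsylow q Q)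
      (hsylow p P) (IsPGroup.disjoint_of_ne q p hqp _ _ Q.2 P.2) u y (hQ (mem_zpowers u)) hy).symm
  exact (mem_centralizer_iff.1 h d (hP hd)).symm

section NilpotentMaximal

variable {G : Type*} [Group G] [Finite G] {p : ℕ} [Fact p.Prime]

theorem IsCoatom.exists_sylow_normalizer_eq {L : Subgroup G} (hL : IsCoatom L)
    (hLnil : Group.IsNilpotent L) (hcore : L.normalCore = ⊥) (hpL : p ∣ Nat.card L) :
    ∃ P : Sylow p G, (P : Subgroup G) ≤ L ∧ normalizer (P : Set G) = L := by
  obtain ⟨S⟩ : Nonempty (Sylow p L) := inferInstance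
  set T : Subgroup G := (S : Subgroup L).map L.subtype with hT
  have hSn : (S : Subgroup L).Normal :=
    S.normal_of_normalizerCondition Group.normalizerCondition_of_isNilpotent
  have hTL : T ≤ L := map_subtype_le _
  have hTne : T ≠ ⊥ := by
    rw [Ne, hT, map_eq_bot_iff_of_injective _ L.subtype_injective]
    exact S.ne_bot_of_dvd_card hpL
  have hLT : L ≤ normalizer (T : Set G) := by
    have h1 := le_normalizer_map L.subtype (H := (S : Subgroup L))
    rwa [normalizer_eq_top, ← MonoidHom.range_eq_map, range_subtype] at h1
  have hN : normalizer (T : Set G) = L := by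
    refine (hL.le_iff.1 hLT).resolve_left fun e => hTne ?_
    have : T.Normal := normalizer_eq_top_iff.1 e
    exact le_bot_iff.1 (hcore ▸ normal_le_normalCore.2 hTL)
  obtain ⟨P, hTP⟩ := (S.2.map L.subtype).exists_le_sylow
  rcases hTP.eq_or_lt with e | hlt
  · refine ⟨P, e ▸ hTL, ?_⟩
    change normalizer ((P : Subgroup G) : Set G) = L
    rw [← e]
    exact hN
  · obtain ⟨g, hgP, hgT, hgN⟩ := P.2.exists_mem_normalizer_of_lt hlt
    have hgL : g ∈ L := hN ▸ hgN
    have h2 : (P : Subgroup G).subgroupOf L = S := S.3 P.2.comap_subtype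
      fun s hs => hTP (mem_map_of_mem L.subtype hs)
    exact absurd ⟨⟨g, hgL⟩, h2 ▸ hgP, rfl⟩ hgT

theorem thompsonCondition_of_isCoatom {L : Subgroup G} (hL : IsCoatom L)
    (hLnil : Group.IsNilpotent L) (hcore : L.normalCore = ⊥) (hpL : p ∣ Nat.card L) :
    ThompsonCondition p G := by
  obtain ⟨P, hPL, hPN⟩ := hL.exists_sylow_normalizer_eq hLnil hcore hpL
  intro S X hX hX1
  obtain ⟨g, rfl⟩ := MulAction.exists_smul_eq G P S
  have hS : ((g • P : Sylow p G) : Subgroup G) =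
      (P : Subgroup G).map (MulAut.conj g).toMonoidHom := rfl
  have h1 : L.map (MulAut.conj g).toMonoidHom ≤ normalizer (X : Set G) := by
    refine le_trans (le_of_eq ?_) hX.normalizer_le
    rw [hS, ← hPN]
    exact map_equiv_normalizer_eq (P : Subgroup G) (MulAut.conj g)
  have h2 : IsCoatom (L.map (MulAut.conj g).toMonoidHom) :=
    ((MulAut.conj g).mapSubgroup.isCoatom_iff L).2 hL
  rcases h2.le_iff.1 h1 with e | e
  · have hXn : X.Normal := normalizer_eq_top_iff.1 e
    refine absurd (le_bot_iff.1 (hcore ▸ normal_le_normalCore.2 fun x hx => hPL ?_)) hX1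
    have h3 := hX.1 (hXn.conj_mem x hx g)
    rw [hS] at h3
    obtain ⟨y, hy, hyx⟩ := h3
    have h4 : y = x := (MulAut.conj g).injective hyx
    exact h4 ▸ hy
  · rw [e]
    exact (FrobeniusCondition.top_iff.1 FrobeniusCondition.top_of_isNilpotent).map
      (MulAut.conj g).injective

theorem Group.isSolvable_of_isCoatom_of_not_dvd (hp2 : p ≠ 2) {L R : Subgroup G}
    (hL : IsCoatom L) (hR : IsCoatom R) (hLnil : Group.IsNilpotent L) (hLcore : L.normalCore = ⊥)
    (hRcore : R.normalCore = ⊥) (hpL : p ∣ Nat.card L) (hpR : ¬ p ∣ Nat.card R) :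
    Group.IsSolvable G := by
  have hp := Fact.out (p := p.Prime)
  obtain ⟨K, hK, hKp, hKx⟩ := ((thompsonCondition_of_isCoatom hL hLnil hLcore
    hpL).frobeniusCondition_top hp2).exists_normal_complement
  have hRK : R ≤ K := fun r hr => hKx r fun hd => hpR (hd.trans (R.orderOf_dvd_natCard hr))
  have hKR : K = R := by
    refine (hR.le_iff.1 hRK).resolve_left ?_
    rintro rfl
    exact hKp (card_top (G := G) ▸ hpL.trans (card_subgroup_dvd_card L))
  have hK1 : K = ⊥ := le_bot_iff.1 (hRcore ▸ normal_le_normalCore.2 hKR.le)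
  have hGp : IsPGroup p G := by
    intro g
    obtain ⟨k, hk⟩ := exists_not_dvd_orderOf_pow hp g
    exact ⟨k, mem_bot.1 (hK1 ▸ hKx _ hk)⟩
  have := hGp.isNilpotent
  infer_instance

end NilpotentMaximal

theorem exists_map_conj_eq_of_normalCore_eq_bot {G : Type*} [Group G] [Finite G]
    (hG : ¬ Group.IsSolvable G) {L R : Subgroup G}
    (hL : IsCoatom L) (hR : IsCoatom R) (hLnil : Group.IsNilpotent L)
    (hRnil : Group.IsNilpotent R) (hLcore : L.normalCore = ⊥) (hRcore : R.normalCore = ⊥) :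
    ∃ g : G, L.map (MulAut.conj g).toMonoidHom = R := by
  by_cases hLR : L = R
  · subst hLR
    refine ⟨1, ?_⟩
    rw [map_one]
    exact map_id L
  by_cases hcommon : ∃ p : ℕ, p.Prime ∧ p ∣ Nat.card L ∧ p ∣ Nat.card R
  · obtain ⟨p, hp, hpL, hpR⟩ := hcommon
    have : Fact p.Prime := ⟨hp⟩
    obtain ⟨P, -, hP⟩ := hL.exists_sylow_normalizer_eq hLnil hLcore hpL
    obtain ⟨Q, -, hQ⟩ := hR.exists_sylow_normalizer_eq hRnil hRcore hpR
    obtain ⟨g, rfl⟩ := MulAction.exists_smul_eq G P Q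
    refine ⟨g, ?_⟩
    rw [← hP, ← hQ]
    exact map_equiv_normalizer_eq (P : Subgroup G) (MulAut.conj g)
  exfalso
  push Not at hcommon
  have h1 : ∀ p : ℕ, p.Prime → p ≠ 2 → ¬ p ∣ Nat.card L := fun p hp hp2 hpL =>
    have : Fact p.Prime := ⟨hp⟩
    hG (Group.isSolvable_of_isCoatom_of_not_dvd hp2 hL hR hLnil hLcore hRcore hpL
      (hcommon p hp hpL))
  have h2 : ∀ p : ℕ, p.Prime → p ≠ 2 → ¬ p ∣ Nat.card R := fun p hp hp2 hpR =>
    have : Fact p.Prime := ⟨hp⟩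
    hG (Group.isSolvable_of_isCoatom_of_not_dvd hp2 hR hL hRnil hRcore hLcore hpR
      fun hpL => hcommon p hp hpL hpR)
  have h3 : ∀ {H : Subgroup G}, H ≠ ⊥ → (∀ p : ℕ, p.Prime → p ≠ 2 → ¬ p ∣ Nat.card H) →
      2 ∣ Nat.card H := by
    intro H hH h
    obtain ⟨p, hp, hpH⟩ := Nat.exists_prime_and_dvd (mt (card_eq_one (H := H)).1 hH)
    by_cases hp2 : p = 2
    · exact hp2 ▸ hpH
    · exact absurd hpH (h p hp hp2)
  by_cases hL1 : L = ⊥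
  · exact (hL.le_iff.1 (hL1 ▸ bot_le : L ≤ R)).elim hR.1 fun e => hLR e.symm
  by_cases hR1 : R = ⊥
  · exact (hR.le_iff.1 (hR1 ▸ bot_le : R ≤ L)).elim hL.1 hLR
  exact hcommon 2 Nat.prime_two (h3 hL1 h1) (h3 hR1 h2)

theorem Subgroup.normalCore_le_of_isCoatom {G : Type*} [Group G] (hG : ¬ Group.IsSolvable G)
    {L R : Subgroup G} (hR : IsCoatom R) (hLnil : Group.IsNilpotent L) (hRnil : Group.IsNilpotent R) :
    L.normalCore ≤ R := by
  by_contra hne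
  have htop : R ⊔ L.normalCore = ⊤ := hR.2 _ (left_lt_sup.2 hne)
  apply hG
  have h1 : Group.IsSolvable L.normalCore :=
    Group.isSolvable_of_isSolvable_injective (inclusion_injective L.normalCore_le)
  let f : R →* G ⧸ L.normalCore := (QuotientGroup.mk' L.normalCore).comp R.subtype
  have hf : Function.Surjective f := by
    intro y
    obtain ⟨g, rfl⟩ := QuotientGroup.mk'_surjective _ y
    obtain ⟨r, hr, c, hc, rfl⟩ := mem_sup_of_normal_right.1 (htop ▸ mem_top g)
    refine ⟨⟨r, hr⟩, ?_⟩
    have hc1 : QuotientGroup.mk' L.normalCore c = 1 := (QuotientGroup.eq_one_iff c).2 hc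
    rw [map_mul, hc1, mul_one]
    rfl
  exact (Group.isSolvable_iff_subgroup_quotient L.normalCore).2
    ⟨h1, Group.isSolvable_of_surjective hf⟩

theorem stmt6 {G : Type*} [Group G] [Fintype G] (hG : ¬ IsSolvable G)
    (L R : Subgroup G) (hL : IsCoatom L) (hR : IsCoatom R)
    (hLnil : Group.IsNilpotent ↥L) (hRnil : Group.IsNilpotent ↥R) :
    ∃ g : G, L.map (MulAut.conj g).toMonoidHom = R := by
  have hLR : L.normalCore = R.normalCore :=
    le_antisymm (normal_le_normalCore.2 (normalCore_le_of_isCoatom hG hR hLnil hRnil))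
      (normal_le_normalCore.2 (normalCore_le_of_isCoatom hG hL hRnil hLnil))
  set C := L.normalCore with hC
  set f := QuotientGroup.mk' C with hfdef
  have hf : Function.Surjective f := QuotientGroup.mk'_surjective C
  have hker : f.ker = C := QuotientGroup.ker_mk' C
  have hCsolv : Group.IsSolvable C :=
    Group.isSolvable_of_isSolvable_injective (inclusion_injective L.normalCore_le)
  have hQ : ¬ Group.IsSolvable (G ⧸ C) := fun h =>
    hG ((Group.isSolvable_iff_subgroup_quotient C).2 ⟨hCsolv, h⟩)
  have hcomap : ∀ {H : Subgroup G}, C ≤ H → (H.map f).comap f = H := fun h =>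
    comap_map_eq_self (hker.trans_le h)
  have hcoatom : ∀ {H : Subgroup G}, C ≤ H → IsCoatom H → IsCoatom (H.map f) := by
    intro H hCH hH
    refine ⟨fun e => hH.1 ?_, fun K hK => ?_⟩
    · rw [← hcomap hCH, e, comap_top]
    · rw [← map_comap_eq_self_of_surjective hf K, hH.2 (K.comap f), map_top_of_surjective f hf]
      rw [← hcomap hCH]
      exact (comap_lt_comap_of_surjective hf).2 hK
  have hnil : ∀ {H : Subgroup G}, Group.IsNilpotent H → Group.IsNilpotent (H.map f) := fun h =>
    Group.nilpotent_of_surjective (f.subgroupMap _) (f.subgroupMap_surjective _)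
  have hcore : ∀ {H : Subgroup G}, H.normalCore = C → (H.map f).normalCore = ⊥ := by
    intro H hH
    have h1 : (H.map f).normalCore.comap f ≤ C := by
      refine le_trans (normal_le_normalCore.2 ?_) hH.le
      exact (comap_mono (normalCore_le _)).trans (hcomap (hH.ge.trans H.normalCore_le)).le
    rw [← map_comap_eq_self_of_surjective hf (H.map f).normalCore, Subgroup.map_eq_bot_iff, hker]
    exact h1
  have hCL : C ≤ L := L.normalCore_le
  have hCR : C ≤ R := hLR.trans_le R.normalCore_le
  obtain ⟨x, hx⟩ := exists_map_conj_eq_of_normalCore_eq_bot hQ (hcoatom hCL hL) (hcoatom hCR hR)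
    (hnil hLnil) (hnil hRnil) (hcore rfl) (hcore hLR.symm)
  obtain ⟨g, rfl⟩ := hf x
  refine ⟨g, ?_⟩
  have hcomp : (MulAut.conj (f g)).toMonoidHom.comp f = f.comp (MulAut.conj g).toMonoidHom := by
    ext y
    simp
  rw [map_map, hcomp, ← map_map] at hx
  have hCg : C ≤ L.map (MulAut.conj g).toMonoidHom := by
    have := map_mono (f := (MulAut.conj g).toMonoidHom) hCL
    rwa [show C.map (MulAut.conj g).toMonoidHom = C from Normal.map_conj_eq C g] at this
  rw [← hcomap hCg, hx, hcomap hCR]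
end

section
/- Let G be a finite group in which every non-nilpotent maximal subgroup is normal. Then G is solvable. -/
namespace Subgroup

variable {G : Type*} [Group G]

theorem exists_mem_normalizer_notMem_of_lt {H K : Subgroup G} [Group.IsNilpotent K] (hHK : H < K) :
    ∃ x ∈ K, x ∈ normalizer (H : Set G) ∧ x ∉ H := by
  have hlt : H.subgroupOf K < ⊤ := by
    rw [lt_top_iff_ne_top, Ne, subgroupOf_eq_top]
    exact hHK.not_ge
  obtain ⟨x, hx, hxH⟩ :=
    SetLike.exists_of_lt (Group.normalizerCondition_of_isNilpotent (G := K) _ hlt)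
  rw [← subgroupOf_normalizer_eq hHK.le] at hx
  exact ⟨x, x.2, hx, hxH⟩

/-- In a group without nontrivial solvable normal subgroups, a nilpotent maximal subgroup is the
normalizer of each of its nontrivial normal subgroups. -/
theorem normalizer_eq_of_isCoatom_of_isNilpotent
    (hsol : ∀ N : Subgroup G, N.Normal → Group.IsSolvable N → N = ⊥)
    {M Q : Subgroup G} (hM : IsCoatom M) [Group.IsNilpotent M] (hQM : Q ≤ M) (hQ : Q ≠ ⊥)
    (hn : (Q.subgroupOf M).Normal) : normalizer (Q : Set G) = M := by
  refine (hM.le_iff.1 (le_normalizer_of_normal_subgroupOf hQM)).resolve_left fun htop => hQ ?_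
  exact hsol Q (normalizer_eq_top_iff.1 htop) (Group.isSolvable_of_isSolvable_injective
    (inclusion_injective hQM))

theorem exists_sylow_normalizer_eq_of_isCoatom [Finite G]
    (hsol : ∀ N : Subgroup G, N.Normal → Group.IsSolvable N → N = ⊥)
    {M : Subgroup G} (hM : IsCoatom M) [Group.IsNilpotent M] {q : ℕ} [hq : Fact q.Prime]
    (hqM : q ∣ Nat.card M) : ∃ Q : Sylow q G, normalizer (Q : Set G) = M := by
  let R : Sylow q M := default
  let Q : Subgroup G := (R : Subgroup M).map M.subtype
  have hQM : Q ≤ M := map_subtype_le _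
  have hQR : Q.subgroupOf M = R := by
    simp [Q, subgroupOf, comap_map_eq_self_of_injective M.subtype_injective]
  have hcard : Nat.card Q = q ^ (Nat.card M).factorization q := by
    rw [card_map_of_injective M.subtype_injective]
    exact R.card_eq_multiplicity
  have hQ : Q ≠ ⊥ := by
    rw [Ne, map_eq_bot_iff_of_injective _ M.subtype_injective]
    exact R.ne_bot_of_dvd_card hqM
  have hnorm : normalizer (Q : Set G) = M :=
    normalizer_eq_of_isCoatom_of_isNilpotent hsol hM hQM hQ (hQR ▸ inferInstance)
  have hfac : (Nat.card M).factorization q = (Nat.card G).factorization q := by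
    refine le_antisymm ((Nat.factorization_le_iff_dvd Nat.card_pos.ne' Nat.card_pos.ne').2
      M.card_subgroup_dvd_card q) (not_lt.1 fun hlt => ?_)
    have hdvd : q ^ ((Nat.card M).factorization q + 1) ∣ Nat.card G :=
      (pow_dvd_pow q hlt).trans (Nat.ordProj_dvd _ _)
    have := Sylow.prime_pow_dvd_card_normalizer hdvd hcard
    rw [hnorm] at this
    exact Nat.pow_succ_factorization_not_dvd Nat.card_pos.ne' hq.out this
  exact ⟨Sylow.ofCard Q (hfac ▸ hcard), hnorm⟩

theorem isCoatom_map_conj {M : Subgroup G} (hM : IsCoatom M) (x : G) :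
    IsCoatom (M.map (MulAut.conj x).toMonoidHom) :=
  ((MulAut.conj x).mapSubgroup.isCoatom_iff M).2 hM

/-- If a subgroup meets its conjugates by outside elements trivially, then the nontrivial elements
of its conjugates together with a transversal account for the whole group. -/
theorem ncard_conjugates_add_index [Finite G] (M : Subgroup G)
    (hTI : ∀ x m : G, m ∈ M → m ≠ 1 → x * m * x⁻¹ ∈ M → x ∈ M) :
    {g : G | g ≠ 1 ∧ ∃ x : G, x⁻¹ * g * x ∈ M}.ncard + M.index = Nat.card G := by
  let f : (G ⧸ M) × {m : M // m ≠ 1} → G := fun a => a.1.out * a.2.1 * a.1.out⁻¹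
  have hf : Function.Injective f := by
    rintro ⟨a, ⟨m, hm⟩, hm1⟩ ⟨b, ⟨n, hn⟩, hn1⟩ hab
    simp only [f] at hab
    have hm1' : m ≠ 1 := fun h0 => hm1 (Subtype.ext h0)
    have hmem : b.out⁻¹ * a.out ∈ M := by
      refine hTI _ m hm hm1' ?_
      have : b.out⁻¹ * a.out * m * (b.out⁻¹ * a.out)⁻¹ = n := by
        rw [show b.out⁻¹ * a.out * m * (b.out⁻¹ * a.out)⁻¹
          = b.out⁻¹ * (a.out * m * a.out⁻¹) * b.out by group, hab]
        group
      rwa [this]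
    have hba : b = a := by
      rw [← QuotientGroup.out_eq' a, ← QuotientGroup.out_eq' b]
      exact QuotientGroup.eq.2 hmem
    subst hba
    have hmn : m = n := mul_left_cancel (mul_right_cancel hab)
    subst hmn
    rfl
  have hrange : Set.range f = {g : G | g ≠ 1 ∧ ∃ x : G, x⁻¹ * g * x ∈ M} := by
    ext g
    constructor
    · rintro ⟨⟨a, ⟨m, hm⟩, hm1⟩, rfl⟩
      refine ⟨fun h0 => hm1 (Subtype.ext (conj_eq_one_iff.1 h0)), a.out, ?_⟩
      simpa [f, mul_assoc] using hm
    · rintro ⟨hg, x, hx⟩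
      obtain ⟨k, hk⟩ := QuotientGroup.mk_out_eq_mul M x
      have hmem : (x * k)⁻¹ * g * (x * k) ∈ M := by
        have := M.mul_mem (M.mul_mem (M.inv_mem k.2) hx) k.2
        simpa [mul_assoc] using this
      refine ⟨⟨(x : G ⧸ M), ⟨⟨_, hmem⟩, fun h0 => hg ?_⟩⟩, ?_⟩
      · have h1 : (x * k)⁻¹ * g * (x * k) = 1 := congrArg Subtype.val h0
        simpa using (conj_eq_one_iff (a := (x * (k : G))⁻¹)).1 (by simpa using h1)
      · simp only [f, hk]
        group
  have hsub : Nat.card {m : M // m ≠ 1} + 1 = Nat.card M := by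
    have := Set.ncard_add_ncard_compl ({1} : Set M)
    rw [Set.ncard_singleton, add_comm] at this
    exact this
  rw [← hrange, ← Nat.card_coe_set_eq, Nat.card_range_of_injective hf, Nat.card_prod,
    ← M.index_mul_card, ← hsub, mul_add, mul_one]
  rfl

end Subgroup

open Subgroup

section NonNilpotentNormal

variable {G : Type*} [Group G] [Finite G]

theorem Sylow.isCoatom_normalizer_and_isNilpotent
    (h : ∀ M : Subgroup G, IsCoatom M → ¬ Group.IsNilpotent M → M.Normal)
    (hsol : ∀ N : Subgroup G, N.Normal → Group.IsSolvable N → N = ⊥)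
    {p : ℕ} [Fact p.Prime] (hp : p ∣ Nat.card G) (P : Sylow p G) :
    IsCoatom (normalizer (P : Set G)) ∧ Group.IsNilpotent (normalizer (P : Set G)) := by
  have hP : (P : Subgroup G) ≠ ⊥ := P.ne_bot_of_dvd_card hp
  have htop : normalizer (P : Set G) ≠ ⊤ := fun htop => hP <| by
    have : Group.IsNilpotent P := P.isPGroup'.isNilpotent
    exact hsol P (normalizer_eq_top_iff.1 htop) inferInstance
  obtain ⟨M, hM, hPM⟩ := (eq_top_or_exists_le_coatom _).resolve_left htop
  have hle : (P : Subgroup G) ≤ M := (P : Subgroup G).le_normalizer.trans hPM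
  have hnil : Group.IsNilpotent M := by
    by_contra hnil
    have := h M hM hnil
    apply hM.1
    rw [← P.normalizer_sup_eq_top' hle]
    exact (sup_eq_right.2 hPM).symm
  have hn : ((P : Subgroup G).subgroupOf M).Normal := by
    rw [← P.coe_subtype hle]
    infer_instance
  have heq : normalizer (P : Set G) = M :=
    normalizer_eq_of_isCoatom_of_isNilpotent hsol hM hle hP hn
  rw [heq]
  exact ⟨hM, hnil⟩

theorem eq_bot_or_eq_top_of_nonnilpotent_coatom_normal
    (h : ∀ M : Subgroup G, IsCoatom M → ¬ Group.IsNilpotent M → M.Normal)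
    (hsol : ∀ N : Subgroup G, N.Normal → Group.IsSolvable N → N = ⊥)
    (K : Subgroup G) [K.Normal] : K = ⊥ ∨ K = ⊤ := by
  by_contra! hK
  obtain ⟨q, hq, hqK⟩ := Nat.exists_prime_and_dvd (mt index_eq_one.1 hK.2)
  have := Fact.mk hq
  have hqG : q ∣ Nat.card G := hqK.trans K.index_dvd_card
  let Q : Sylow q G := default
  obtain ⟨hQ, -⟩ := Q.isCoatom_normalizer_and_isNilpotent h hsol hqG
  apply hQ.1
  rw [← index_eq_one]
  by_contra hne
  obtain ⟨p, hp, hpQ⟩ := Nat.exists_prime_and_dvd hne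
  have := Fact.mk hp
  have hpG : p ∣ Nat.card G := hpQ.trans (index_dvd_card _)
  let P : Sylow p G := default
  obtain ⟨hM, hnil⟩ := P.isCoatom_normalizer_and_isNilpotent h hsol hpG
  have hKM : ¬ K ≤ normalizer (P : Set G) := fun hle =>
    hK.1 (hsol K inferInstance (Group.isSolvable_of_isSolvable_injective (inclusion_injective hle)))
  have hsup : normalizer (P : Set G) ⊔ K = ⊤ := hM.2 _ (left_lt_sup.2 hKM)
  have hqM : q ∣ Nat.card (normalizer (P : Set G)) := by
    refine hqK.trans ?_
    rw [← K.relIndex_top_right, ← hsup, relIndex_sup_right]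
    exact relIndex_dvd_card _ _
  obtain ⟨Q', hQ'⟩ := exists_sylow_normalizer_eq_of_isCoatom hsol hM hqM
  rw [← Q.card_eq_index_normalizer, Q'.card_eq_index_normalizer, hQ'] at hpQ
  exact P.not_dvd_index (hpQ.trans (index_dvd_of_le (P : Subgroup G).le_normalizer))

end NonNilpotentNormal

section Schmidt

variable {G : Type*} [Group G] [Finite G] [IsSimpleGroup G]

theorem IsSimpleGroup.inf_eq_bot_of_isCoatom
    (h : ∀ M : Subgroup G, IsCoatom M → Group.IsNilpotent M)
    {M M' : Subgroup G} (hM : IsCoatom M) (hM' : IsCoatom M') (hne : M ≠ M') : M ⊓ M' = ⊥ := by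
  by_contra hbot
  let S : Set (Subgroup G) :=
    {D | D ≠ ⊥ ∧ ∃ A B, IsCoatom A ∧ IsCoatom B ∧ A ≠ B ∧ A ⊓ B = D}
  obtain ⟨D, ⟨hD, A, B, hA, hB, hAB, rfl⟩, hmax⟩ :=
    (Set.toFinite S).exists_maximal ⟨_, hbot, M, M', hM, hM', hne, rfl⟩
  have htop : normalizer ((A ⊓ B : Subgroup G) : Set G) ≠ ⊤ := fun htop => by
    rcases (normalizer_eq_top_iff.1 htop).eq_bot_or_eq_top with h1 | h1
    · exact hD h1
    · exact hA.1 (top_le_iff.1 (h1 ▸ inf_le_left))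
  obtain ⟨C, hC, hDC⟩ := (eq_top_or_exists_le_coatom _).resolve_left htop
  have key : ∀ X : Subgroup G, IsCoatom X → A ⊓ B < X → X = C := by
    intro X hX hlt
    by_contra hXC
    have := h X hX
    obtain ⟨x, hxX, hxN, hxD⟩ := exists_mem_normalizer_notMem_of_lt hlt
    have hle : A ⊓ B ≤ X ⊓ C := le_inf hlt.le (Subgroup.le_normalizer.trans hDC)
    have hmem : X ⊓ C ∈ S :=
      ⟨fun h0 => hD (le_bot_iff.1 (h0 ▸ hle)), X, C, hX, hC, hXC, rfl⟩
    exact hxD (hmax hmem hle ⟨hxX, hDC hxN⟩)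
  have hltA : A ⊓ B < A := inf_lt_left.2 fun hle =>
    hAB ((hA.le_iff.1 hle).resolve_left hB.1).symm
  have hltB : A ⊓ B < B := inf_lt_right.2 fun hle =>
    hAB ((hB.le_iff.1 hle).resolve_left hA.1)
  exact hAB ((key A hA hltA).trans (key B hB hltB).symm)

theorem IsSimpleGroup.map_conj_eq_of_isCoatom
    (h : ∀ M : Subgroup G, IsCoatom M → Group.IsNilpotent M)
    {M M' : Subgroup G} (hM : IsCoatom M) (hM' : IsCoatom M') {x m : G} (hm : m ∈ M) (hm1 : m ≠ 1)
    (hx : x * m * x⁻¹ ∈ M') : M.map (MulAut.conj x).toMonoidHom = M' := by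
  by_contra hne
  have hbot := inf_eq_bot_of_isCoatom h (isCoatom_map_conj hM x) hM' hne
  have hmem : x * m * x⁻¹ ∈ M.map (MulAut.conj x).toMonoidHom ⊓ M' := ⟨⟨m, hm, rfl⟩, hx⟩
  rw [hbot, mem_bot] at hmem
  exact hm1 (conj_eq_one_iff.1 hmem)

/-- **Schmidt's theorem** for simple groups. -/
theorem IsSimpleGroup.isSolvable_of_forall_isCoatom_isNilpotent
    (h : ∀ M : Subgroup G, IsCoatom M → Group.IsNilpotent M) : Group.IsSolvable G := by
  by_contra hG
  have hcyc : ∀ g : G, zpowers g ≠ ⊤ := fun g hg => hG <| by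
    have : IsCyclic G := ⟨g, fun x => mem_zpowers_iff.1 (hg ▸ mem_top x)⟩
    exact Group.isSolvable_of_comm fun a b => IsCyclic.commGroup.mul_comm a b
  have hcover : ∀ g : G, ∃ M : Subgroup G, IsCoatom M ∧ g ∈ M := fun g => by
    obtain ⟨M, hM, hle⟩ := (eq_top_or_exists_le_coatom _).resolve_left (hcyc g)
    exact ⟨M, hM, hle (mem_zpowers g)⟩
  have hbot : ∀ M : Subgroup G, IsCoatom M → M ≠ ⊥ := by
    rintro M hM rfl
    obtain ⟨g, hg⟩ := exists_ne (1 : G)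
    exact hcyc g (hM.2 _ (bot_lt_iff_ne_bot.2 (mt zpowers_eq_bot.1 hg)))
  have hTI : ∀ M : Subgroup G, IsCoatom M →
      ∀ x m : G, m ∈ M → m ≠ 1 → x * m * x⁻¹ ∈ M → x ∈ M := by
    intro M hM x m hm hm1 hx
    have hnorm : normalizer (M : Set G) = M := by
      refine (hM.le_iff.1 M.le_normalizer).resolve_left fun htop => ?_
      rcases (normalizer_eq_top_iff.1 htop).eq_bot_or_eq_top with h1 | h1
      · exact hbot M hM h1
      · exact hM.1 h1
    rw [← hnorm]
    exact mem_normalizer_iff_map_conj_eq.2 (map_conj_eq_of_isCoatom h hM hM hm hm1 hx)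
  have hindex : ∀ M : Subgroup G, IsCoatom M → M.index * 2 ≤ Nat.card G := fun M hM => by
    rw [← M.index_mul_card]
    exact Nat.mul_le_mul_left _ (M.one_lt_card_iff_ne_bot.2 (hbot M hM))
  let S : Subgroup G → Set G := fun M => {g | g ≠ 1 ∧ ∃ x : G, x⁻¹ * g * x ∈ M}
  obtain ⟨M, hM, -⟩ := hcover 1
  have hcard := M.ncard_conjugates_add_index (hTI M hM)
  have hcompl : (S M).ncard < ({1}ᶜ : Set G).ncard := by
    have := Set.ncard_add_ncard_compl ({1} : Set G)
    rw [Set.ncard_singleton] at this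
    have := one_lt_index_of_ne_top hM.1
    change (S M).ncard + _ = _ at hcard
    omega
  obtain ⟨g, hg1, hgM⟩ := Set.exists_mem_notMem_of_ncard_lt_ncard hcompl
  obtain ⟨M', hM', hgM'⟩ := hcover g
  have hcard' := M'.ncard_conjugates_add_index (hTI M' hM')
  have hdisj : Disjoint (S M) (S M') := by
    rw [Set.disjoint_left]
    rintro y ⟨hy, x, hx⟩ ⟨-, x', hx'⟩
    have heq : M'.map (MulAut.conj (x⁻¹ * x')).toMonoidHom = M := by
      refine map_conj_eq_of_isCoatom h hM' hM hx' (fun h0 => hy ?_) ?_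
      · simpa using (conj_eq_one_iff (a := x'⁻¹)).1 (by simpa using h0)
      · convert hx using 1
        group
    refine hgM ⟨hg1, (x⁻¹ * x')⁻¹, ?_⟩
    rw [← heq]
    exact ⟨g, hgM', by simp [mul_assoc]⟩
  have hunion : (S M ∪ S M').ncard ≤ ({1}ᶜ : Set G).ncard :=
    Set.ncard_le_ncard (Set.union_subset (fun _ hy => hy.1) (fun _ hy => hy.1))
  rw [Set.ncard_union_eq hdisj] at hunion
  have hone := Set.ncard_add_ncard_compl ({1} : Set G)
  rw [Set.ncard_singleton] at hone
  have h1 := hindex M hM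
  have h2 := hindex M' hM'
  change (S M).ncard + _ = _ at hcard
  change (S M').ncard + _ = _ at hcard'
  omega

end Schmidt

theorem isSolvable_of_nonnilpotent_coatom_normal {G : Type*} [Group G] [Finite G]
    (h : ∀ M : Subgroup G, IsCoatom M → ¬ Group.IsNilpotent M → M.Normal) : Group.IsSolvable G := by
  induction hn : Nat.card G using Nat.strong_induction_on generalizing G with
  | _ n ih =>
  subst hn
  by_contra hG
  have hsol : ∀ N : Subgroup G, N.Normal → Group.IsSolvable N → N = ⊥ := by
    intro N hN hNs
    by_contra hbot
    have hquot : Group.IsSolvable (G ⧸ N) := by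
      refine ih (Nat.card (G ⧸ N)) ?_ (fun M hM hnil => ?_) rfl
      · rw [N.card_eq_card_quotient_mul_card_subgroup]
        exact lt_mul_of_one_lt_right Nat.card_pos (N.one_lt_card_iff_ne_bot.2 hbot)
      · have hsurj := QuotientGroup.mk'_surjective N
        rw [← map_comap_eq_self_of_surjective hsurj M]
        refine (h _ (isCoatom_comap_of_surjective hsurj hM) fun hnil' => hnil ?_).map _ hsurj
        exact Group.nilpotent_of_surjective _
          ((QuotientGroup.mk' N).subgroupComap_surjective_of_surjective M hsurj)
    exact hG ((Group.isSolvable_iff_subgroup_quotient N).2 ⟨hNs, hquot⟩)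
  have : Nontrivial G := not_subsingleton_iff_nontrivial.1 fun _ => hG inferInstance
  have : IsSimpleGroup G :=
    ⟨fun K _ => eq_bot_or_eq_top_of_nonnilpotent_coatom_normal h hsol K⟩
  refine hG (IsSimpleGroup.isSolvable_of_forall_isCoatom_isNilpotent fun M hM => ?_)
  by_contra hnil
  rcases (h M hM hnil).eq_bot_or_eq_top with rfl | rfl
  · exact hnil inferInstance
  · exact hM.1 rfl

theorem stmt8 {G : Type*} [Group G] [Fintype G]
    (h : ∀ M : Subgroup G, IsCoatom M → ¬ Group.IsNilpotent ↥M → M.Normal) :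
    IsSolvable G :=
  isSolvable_of_nonnilpotent_coatom_normal h
end
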